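/- Let N be a positive integer, L > 0, and let f : U(N) → ℝ be L-Lipschitz with respect to the Frobenius norm, i.e. |f(U) − f(V)| ≤ L·‖U − V‖_F for all U, V ∈ U(N). Then for every t > 0, if U and U' are sampled independently from the Haar probability measure μ_N, (μ_N × μ_N)({(U,U') : |f(U) − f(U')| ≥ t}) ≤ 2·exp(−(N−2)·t² / (48·L²)). -/

import Mathlib

open MeasureTheory

/-- The Frobenius norm `‖M‖_F = sqrt (∑_{i,j} |M i j|²)` of a complex matrix. -/
noncomputable def frobNorm {m n : Type*} [Fintype m] [Fintype n]
    (M : Matrix m n ℂ) : ℝ :=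
  Real.sqrt (∑ i, ∑ j, ‖M i j‖ ^ 2)

section Basics
open scoped Matrix Matrix.Norms.Frobenius

abbrev Mat (N : ℕ) := Matrix (Fin N) (Fin N) ℂ
abbrev UG (N : ℕ) : Type := Matrix.unitaryGroup (Fin N) ℂ

variable {N : ℕ}

lemma norm_sq_mat (A : Mat N) : ‖A‖ ^ 2 = ∑ i, ∑ j, ‖A i j‖ ^ 2 := by
  rw [Matrix.frobenius_norm_def]
  rw [← Real.sqrt_eq_rpow, Real.sq_sqrt]
  · simp
  · positivity

lemma frobNorm_eq (A : Mat N) : frobNorm A = ‖A‖ := by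
  rw [frobNorm, ← norm_sq_mat, Real.sqrt_sq (norm_nonneg _)]

lemma norm_sq_trace (A : Mat N) : ‖A‖ ^ 2 = (Matrix.trace (Aᴴ * A)).re := by
  rw [norm_sq_mat, Matrix.trace, Finset.sum_comm]
  simp [Matrix.mul_apply, ← Complex.normSq_eq_norm_sq, Complex.normSq_apply]

lemma norm_unitary_mul (U : UG N) (A : Mat N) : ‖(U : Mat N) * A‖ = ‖A‖ := by
  have : ‖(U : Mat N) * A‖ ^ 2 = ‖A‖ ^ 2 := by
    rw [norm_sq_trace, norm_sq_trace, Matrix.conjTranspose_mul, Matrix.mul_assoc,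
      ← Matrix.mul_assoc _ (U : Mat N) A]
    have := U.2.1
    rw [Matrix.star_eq_conjTranspose] at this
    rw [this, Matrix.one_mul]
  exact (pow_left_inj₀ (norm_nonneg _) (norm_nonneg _) two_ne_zero).1 this

lemma norm_mul_unitary (A : Mat N) (U : UG N) : ‖A * (U : Mat N)‖ = ‖A‖ := by
  rw [← Matrix.frobenius_norm_conjTranspose, Matrix.conjTranspose_mul]
  have := norm_unitary_mul (U⁻¹) (Aᴴ)
  rw [Matrix.frobenius_norm_conjTranspose] at this
  exact this

lemma coe_inv_UG (U : UG N) : ((U⁻¹ : UG N) : Mat N) = (U : Mat N)ᴴ := rfl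

lemma norm_conj (U : UG N) (A : Mat N) : ‖(U : Mat N) * A * ((U⁻¹ : UG N) : Mat N)‖ = ‖A‖ := by
  rw [norm_mul_unitary, norm_unitary_mul]

lemma parallelogram_mat (A B : Mat N) :
    ‖A + B‖ ^ 2 + ‖A - B‖ ^ 2 = 2 * ‖A‖ ^ 2 + 2 * ‖B‖ ^ 2 := by
  simp only [norm_sq_mat, Finset.mul_sum, ← Finset.sum_add_distrib]
  refine Finset.sum_congr rfl fun i _ => Finset.sum_congr rfl fun j _ => ?_
  have := parallelogram_law_with_norm ℝ (A i j) (B i j)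
  simp only [Matrix.add_apply, Matrix.sub_apply]
  nlinarith

lemma norm_exp_sub (X : Mat N) (hX : ‖X‖ ≤ 1) :
    ‖NormedSpace.exp X - 1 - X‖ ≤ ‖X‖ ^ 2 := by
  have h := NormedSpace.exp_series_hasSum_exp' (𝕂 := ℂ) X
  have h2 := (hasSum_nat_add_iff' 2).2 h
  have e : NormedSpace.exp X - ∑ i ∈ Finset.range 2, ((Nat.factorial i : ℂ)⁻¹) • X ^ i
      = NormedSpace.exp X - 1 - X := by
    simp [Finset.sum_range_succ, sub_sub]
  have hg : HasSum (fun n : ℕ => ‖X‖ ^ 2 * (1 / 2 / 2 ^ n : ℝ)) (‖X‖ ^ 2 * 1) :=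
    (hasSum_geometric_two' 1).mul_left _
  rw [← e]
  erw [← h2.tsum_eq]
  rw [← mul_one (‖X‖ ^ 2)]
  refine tsum_of_norm_bounded hg fun n => ?_
  rw [norm_smul]
  have hf : (2 : ℝ) ^ (n + 1) ≤ (n + 2).factorial := by
    have : 2 ^ (n + 1) ≤ (n + 2).factorial := by
      induction n with
      | zero => simp [Nat.factorial]
      | succ k ih =>
        rw [Nat.factorial_succ, pow_succ]
        nlinarith [Nat.zero_le k]
    exact_mod_cast this
  have h1 : ‖((n + 2).factorial : ℂ)⁻¹‖ ≤ 1 / 2 / 2 ^ n := by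
    rw [norm_inv, Complex.norm_natCast, div_div, ← pow_succ', one_div]
    exact inv_anti₀ (by positivity) hf
  have h3 : ‖X ^ (n + 2)‖ ≤ ‖X‖ ^ 2 := by
    refine (norm_pow_le' X (by omega)).trans ?_
    exact pow_le_pow_of_le_one (norm_nonneg _) hX (by omega)
  calc _ ≤ (1 / 2 / 2 ^ n) * ‖X‖ ^ 2 := by gcongr
    _ = _ := by ring

/-- skew-Hermitian part -/
noncomputable def skewPart (Z : Mat N) : Mat N := (1 / 2 : ℝ) • (Z - Zᴴ)

lemma skewPart_skew (Z : Mat N) : (skewPart Z)ᴴ = - skewPart Z := by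
  simp [skewPart, Matrix.conjTranspose_smul, ← smul_neg]

lemma skewPart_of_skew {Z : Mat N} (h : Zᴴ = -Z) : skewPart Z = Z := by
  rw [skewPart, h, sub_neg_eq_add, ← two_smul ℝ Z, smul_smul]; norm_num

noncomputable def eU (X : Mat N) : UG N :=
  ⟨NormedSpace.exp (skewPart X), by
    refine NormedSpace.exp_mem_unitary_of_mem_skewAdjoint ?_
    rw [skewAdjoint.mem_iff]; exact skewPart_skew X⟩

lemma coe_eU {X : Mat N} (h : Xᴴ = -X) : (eU X : Mat N) = NormedSpace.exp X := by
  change NormedSpace.exp (skewPart X) = _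
  rw [skewPart_of_skew h]

lemma continuous_eU : Continuous (eU : Mat N → UG N) := by
  refine Continuous.subtype_mk ?_ _
  refine NormedSpace.exp_continuous.comp ?_
  unfold skewPart
  fun_prop

instance : IsTopologicalGroup (UG N) := inferInstance

instance : CompactSpace (UG N) := by
  refine (isCompact_iff_compactSpace (s := ((Matrix.unitaryGroup (Fin N) ℂ : Submonoid (Mat N)) : Set (Mat N)))).1 ?_
  refine Metric.isCompact_of_isClosed_isBounded ?_ ?_
  · change IsClosed ((Matrix.unitaryGroup (Fin N) ℂ : Submonoid (Mat N)) : Set (Mat N))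
    have : ((Matrix.unitaryGroup (Fin N) ℂ : Submonoid (Mat N)) : Set (Mat N))
        = {A | star A * A = 1} ∩ {A | A * star A = 1} := by
      ext A; exact Iff.rfl
    rw [this]
    exact (isClosed_eq (by fun_prop) (by fun_prop)).inter (isClosed_eq (by fun_prop) (by fun_prop))
  · refine (Metric.isBounded_iff_subset_closedBall 0).2 ⟨‖(1 : Mat N)‖, fun A hA => ?_⟩
    have := norm_mul_unitary 1 (⟨A, hA⟩ : UG N)
    simp at this ⊢
    rw [this]

lemma norm_UG (U : UG N) : ‖(U : Mat N)‖ = ‖(1 : Mat N)‖ := by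
  simpa using norm_mul_unitary 1 U

lemma conj_skew {X : Mat N} (h : Xᴴ = -X) (W : UG N) :
    ((W : Mat N) * X * ((W⁻¹ : UG N) : Mat N))ᴴ = -((W : Mat N) * X * ((W⁻¹ : UG N) : Mat N)) := by
  rw [coe_inv_UG]; simp [Matrix.conjTranspose_mul, h, Matrix.mul_assoc]

lemma conj_trace (X : Mat N) (W : UG N) :
    Matrix.trace ((W : Mat N) * X * ((W⁻¹ : UG N) : Mat N)) = Matrix.trace X := by
  rw [Matrix.trace_mul_comm, ← Matrix.mul_assoc]
  have : ((W⁻¹ : UG N) : Mat N) * (W : Mat N) = 1 := by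
    rw [← Submonoid.coe_mul]; simp
  rw [this, Matrix.one_mul]

lemma eU_conj {X : Mat N} (h : Xᴴ = -X) (W : UG N) :
    eU ((W : Mat N) * X * ((W⁻¹ : UG N) : Mat N)) = W * eU X * W⁻¹ := by
  apply Subtype.ext
  rw [coe_eU (conj_skew h W)]
  simp only [Submonoid.coe_mul]
  rw [coe_eU h]
  have hi : (W : Mat N)⁻¹ = ((W⁻¹ : UG N) : Mat N) := by
    apply Matrix.inv_eq_left_inv
    rw [← Submonoid.coe_mul]; simp
  rw [← hi]
  refine Matrix.exp_conj _ _ ?_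
  rw [Matrix.isUnit_iff_isUnit_det]
  exact Matrix.UnitaryGroup.det_isUnit W

lemma eU_add_of_commute {X Y : Mat N} (hX : Xᴴ = -X) (hY : Yᴴ = -Y) (h : Commute X Y) :
    eU (X + Y) = eU X * eU Y := by
  apply Subtype.ext
  rw [coe_eU (by rw [Matrix.conjTranspose_add, hX, hY]; abel), Submonoid.coe_mul, coe_eU hX,
    coe_eU hY]
  exact Matrix.exp_add_of_commute _ _ h

lemma eU_neg {X : Mat N} (hX : Xᴴ = -X) : eU (-X) = (eU X)⁻¹ := by
  rw [eq_inv_iff_mul_eq_one, ← eU_add_of_commute (by rw [Matrix.conjTranspose_neg, hX]) hX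
    (Commute.neg_left (Commute.refl X))]
  apply Subtype.ext
  rw [neg_add_cancel, coe_eU (by simp)]
  simp

lemma skew_smul {X : Mat N} (hX : Xᴴ = -X) (s : ℝ) : (s • X)ᴴ = -(s • X) := by
  rw [Matrix.conjTranspose_smul, hX]; simp

lemma skew_add {X Y : Mat N} (hX : Xᴴ = -X) (hY : Yᴴ = -Y) : (X + Y)ᴴ = -(X + Y) := by
  rw [Matrix.conjTranspose_add, hX, hY]; abel

end Basics

section Frame
open scoped Matrix Matrix.Norms.Frobenius
variable {N : ℕ}

/-- projection to traceless matrices -/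
noncomputable def trProj (A : Mat N) : Mat N := A - (Matrix.trace A / N) • (1 : Mat N)

lemma norm_trProj_le (A : Mat N) : ‖trProj A‖ ≤ ‖A‖ := by
  have : ‖trProj A‖ ^ 2 ≤ ‖A‖ ^ 2 := by
    rcases Nat.eq_zero_or_pos N with h | h
    · subst h; simp [norm_sq_mat]
    have hN : (N : ℝ) ≠ 0 := by positivity
    rw [norm_sq_trace, norm_sq_trace, trProj]
    set t := Matrix.trace A with ht
    have h1 : Matrix.trace (Aᴴ) = star t := by rw [ht, Matrix.trace_conjTranspose]
    have h2 : ((A - (t / N) • (1 : Mat N))ᴴ * (A - (t / N) • (1 : Mat N))).trace =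
        (Aᴴ * A).trace - (t / N) * star t - star (t / N) * t + star (t / N) * (t / N) * N := by
      simp only [Matrix.conjTranspose_sub, Matrix.conjTranspose_smul, Matrix.conjTranspose_one,
        Matrix.sub_mul, Matrix.mul_sub, Matrix.trace_sub, Matrix.smul_mul, Matrix.mul_smul,
        Matrix.one_mul, Matrix.mul_one, Matrix.trace_smul, h1, ← ht, Matrix.trace_one]
      simp only [smul_eq_mul, Fintype.card_fin]
      ring
    rw [h2]
    have h3 : (Aᴴ * A).trace - (t / N) * star t - star (t / N) * t + star (t / N) * (t / N) * N
      = (Aᴴ * A).trace - ((Complex.normSq t / N : ℝ) : ℂ) := by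
      have hN' : (N : ℂ) ≠ 0 := by exact_mod_cast h.ne'
      have : star t * t = (Complex.normSq t : ℂ) := by
        rw [mul_comm]; exact Complex.mul_conj t
      push_cast
      rw [← this]
      simp only [star_div₀, star_natCast]
      field_simp
      ring
    rw [h3, Complex.sub_re, Complex.ofReal_re]
    have : 0 ≤ Complex.normSq t / N := div_nonneg (Complex.normSq_nonneg _) (by positivity)
    linarith
  exact (pow_le_pow_iff_left₀ (norm_nonneg _) (norm_nonneg _) two_ne_zero).1 this

lemma norm_skewPart_le (A : Mat N) : ‖skewPart A‖ ≤ ‖A‖ := by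
  rw [skewPart, norm_smul]
  have := norm_sub_le A Aᴴ
  rw [Matrix.frobenius_norm_conjTranspose] at this
  norm_num
  linarith

noncomputable def SS (N : ℕ) : Mat N →ₗ[ℝ] Mat N where
  toFun Z := trProj (skewPart Z)
  map_add' A B := by
    simp only [trProj, skewPart, Matrix.conjTranspose_add, Matrix.trace_smul, Matrix.trace_sub,
      Matrix.trace_add]
    ext i j
    simp only [Matrix.sub_apply, Matrix.add_apply, Matrix.smul_apply, smul_eq_mul, Complex.real_smul]
    ring
  map_smul' r A := by
    simp only [trProj, skewPart, Matrix.conjTranspose_smul, Matrix.trace_smul, Matrix.trace_sub]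
    ext i j
    simp only [Matrix.sub_apply, Matrix.smul_apply, smul_eq_mul, Complex.real_smul, star_trivial,
      RingHom.id_apply]
    ring

lemma SS_apply (Z : Mat N) : SS N Z = trProj (skewPart Z) := rfl

lemma SS_skew (Z : Mat N) : (SS N Z)ᴴ = - SS N Z := by
  rw [SS_apply, trProj]
  have h := skewPart_skew Z
  have ht : star (Matrix.trace (skewPart Z)) = - Matrix.trace (skewPart Z) := by
    rw [← Matrix.trace_conjTranspose, h, Matrix.trace_neg]
  rw [Matrix.conjTranspose_sub, h, Matrix.conjTranspose_smul, star_div₀, ht]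
  simp only [neg_div, neg_smul, Matrix.conjTranspose_one, star_natCast]
  abel

lemma trProj_trace (hN : 0 < N) (A : Mat N) : Matrix.trace (trProj A) = 0 := by
  have : (N : ℂ) ≠ 0 := by exact_mod_cast hN.ne'
  simp [trProj, Matrix.trace_sub, Matrix.trace_smul, this]

lemma SS_trace (hN : 0 < N) (Z : Mat N) : Matrix.trace (SS N Z) = 0 := trProj_trace hN _

lemma norm_SS_le (Z : Mat N) : ‖SS N Z‖ ≤ ‖Z‖ :=
  (norm_trProj_le _).trans (norm_skewPart_le _)

abbrev FI (N : ℕ) : Type := Fin N × Fin N × Bool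

noncomputable def cc (b : Bool) : ℂ := if b then 1 else Complex.I

noncomputable def XX (a : FI N) : Mat N := SS N (Matrix.single a.1 a.2.1 (cc a.2.2))

lemma XX_skew (a : FI N) : (XX a)ᴴ = - XX a := SS_skew _
lemma XX_trace (hN : 0 < N) (a : FI N) : Matrix.trace (XX a) = 0 := SS_trace hN _

lemma XX_norm (a : FI N) : ‖XX a‖ ≤ 1 := by
  refine (norm_SS_le _).trans ?_
  have : ‖Matrix.single a.1 a.2.1 (cc a.2.2)‖ ^ 2 = 1 := by
    rw [norm_sq_mat, Finset.sum_eq_single a.1, Finset.sum_eq_single a.2.1]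
    · rcases h : a.2.2 <;> simp [cc]
    · intro b _ hb; simp [hb.symm]
    · simp
    · intro b _ hb; simp [hb.symm]
    · simp
  have h0 := norm_nonneg (Matrix.single a.1 a.2.1 (cc a.2.2))
  nlinarith

lemma frame_sum (c : FI N → ℝ) : ‖∑ a, c a • XX a‖ ^ 2 ≤ ∑ a, c a ^ 2 := by
  have h1 : ∑ a, c a • XX a = SS N (∑ a : FI N, c a • Matrix.single a.1 a.2.1 (cc a.2.2)) := by
    rw [map_sum]; exact Finset.sum_congr rfl fun a _ => (map_smul (SS N) _ _).symm
  rw [h1]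
  have h2 : ‖∑ a : FI N, c a • Matrix.single a.1 a.2.1 (cc a.2.2)‖ ^ 2 = ∑ a, c a ^ 2 := by
    rw [norm_sq_mat]
    simp only [Fintype.sum_prod_type, Fintype.sum_bool]
    refine Finset.sum_congr rfl fun i _ => Finset.sum_congr rfl fun j _ => ?_
    have : (∑ x, ∑ y, (c (x, y, true) • Matrix.single x y (cc true) +
       c (x, y, false) • Matrix.single x y (cc false)) : Mat N) i j
       = (c (i, j, true) : ℂ) + (c (i, j, false) : ℂ) * Complex.I := by
      simp only [Matrix.sum_apply, Matrix.add_apply, Matrix.smul_apply]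
      rw [Finset.sum_eq_single i, Finset.sum_eq_single j]
      · simp [cc]
      · intro b _ hb; simp [hb]
      · simp
      · intro b _ hb; simp [hb]
      · simp
    rw [this, ← Complex.normSq_eq_norm_sq, Complex.normSq_add_mul_I]
  rw [← h2]
  exact pow_le_pow_left₀ (norm_nonneg _) (norm_SS_le _) 2

lemma SS_comm (Z A : Mat N) : SS N Z * A - A * SS N Z = skewPart Z * A - A * skewPart Z := by
  simp [SS_apply, trProj, Matrix.sub_mul, Matrix.mul_sub]

lemma comm_pair (Z A : Mat N) (hA : Aᴴ = -A) :
    ‖SS N Z * A - A * SS N Z‖ ^ 2 + ‖SS N (Complex.I • Z) * A - A * SS N (Complex.I • Z)‖ ^ 2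
      = ‖Z * A - A * Z‖ ^ 2 := by
  rw [SS_comm, SS_comm]
  set M := Z * A - A * Z with hM
  have hMH : Mᴴ = Zᴴ * A - A * Zᴴ := by
    rw [hM, Matrix.conjTranspose_sub, Matrix.conjTranspose_mul, Matrix.conjTranspose_mul, hA]
    simp only [Matrix.neg_mul, Matrix.mul_neg]; abel
  have e1 : skewPart Z * A - A * skewPart Z = (1 / 2 : ℝ) • (M - Mᴴ) := by
    rw [hMH, hM, skewPart, Matrix.smul_mul, Matrix.mul_smul, ← smul_sub]
    congr 1
    simp only [Matrix.sub_mul, Matrix.mul_sub]; abel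
  have e2 : skewPart (Complex.I • Z) * A - A * skewPart (Complex.I • Z)
      = (1 / 2 : ℝ) • (Complex.I • (M + Mᴴ)) := by
    rw [hMH, hM, skewPart, Matrix.smul_mul, Matrix.mul_smul, ← smul_sub, Matrix.conjTranspose_smul]
    congr 1
    have : star Complex.I = -Complex.I := Complex.conj_I
    rw [this]
    simp only [Matrix.sub_mul, Matrix.mul_sub, Matrix.smul_mul, Matrix.mul_smul, smul_add, smul_sub,
      neg_smul, Matrix.neg_mul, Matrix.mul_neg]; abel
  rw [e1, e2, norm_smul, norm_smul, norm_smul, Complex.norm_I]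
  have := parallelogram_mat M Mᴴ
  rw [Matrix.frobenius_norm_conjTranspose] at this
  norm_num
  nlinarith

lemma single_comm (A : Mat N) (j k : Fin N) :
    ‖Matrix.single j k (1 : ℂ) * A - A * Matrix.single j k (1 : ℂ)‖ ^ 2 =
      (∑ q, ‖A k q‖ ^ 2) + (∑ p, ‖A p j‖ ^ 2) - 2 * ((A k k) * star (A j j)).re := by
  rw [norm_sq_mat]
  have key : ∀ p q, ‖(Matrix.single j k (1 : ℂ) * A - A * Matrix.single j k (1 : ℂ)) p q‖ ^ 2
      = (if p = j then ‖A k q‖ ^ 2 else 0) + (if q = k then ‖A p j‖ ^ 2 else 0)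
        - (if p = j then (if q = k then 2 * ((A k k) * star (A j j)).re else 0) else 0) := by
    intro p q
    have e1 : (Matrix.single j k (1 : ℂ) * A) p q = if p = j then A k q else 0 := by
      split_ifs with h
      · subst h; simp
      · exact Matrix.single_mul_apply_of_ne (c := (1:ℂ)) (h := h) ..
    have e2 : (A * Matrix.single j k (1 : ℂ)) p q = if q = k then A p j else 0 := by
      split_ifs with h
      · subst h; simp
      · exact Matrix.mul_single_apply_of_ne (c := (1:ℂ)) (hbj := h) ..
    rw [Matrix.sub_apply, e1, e2]
    split_ifs with h1 h2 h2
    · subst h1 h2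
      rw [← Complex.normSq_eq_norm_sq, ← Complex.normSq_eq_norm_sq, ← Complex.normSq_eq_norm_sq,
        Complex.normSq_sub]
      rfl
    · simp
    · simp
    · simp
  simp only [key, Finset.sum_sub_distrib, Finset.sum_add_distrib]
  congr 1
  · congr 1
    · rw [Finset.sum_eq_single j]
      · simp
      · intro b _ hb; simp [hb]
      · simp
    · simp
  · simp

lemma frame_comm (A : Mat N) (hA : Aᴴ = -A) (hT : Matrix.trace A = 0) :
    ∑ a : FI N, ‖XX a * A - A * XX a‖ ^ 2 = 2 * N * ‖A‖ ^ 2 := by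
  simp only [Fintype.sum_prod_type, Fintype.sum_bool]
  have h : ∀ j k : Fin N, ‖XX (j, k, true) * A - A * XX (j, k, true)‖ ^ 2 +
      ‖XX (j, k, false) * A - A * XX (j, k, false)‖ ^ 2 =
      (∑ q, ‖A k q‖ ^ 2) + (∑ p, ‖A p j‖ ^ 2) - 2 * ((A k k) * star (A j j)).re := by
    intro j k
    rw [← single_comm, ← comm_pair (Matrix.single j k (1 : ℂ)) A hA]
    have : Complex.I • Matrix.single j k (1 : ℂ) = Matrix.single j k Complex.I := by
      rw [Matrix.smul_single, smul_eq_mul, mul_one]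
    rw [this]
    rfl
  simp only [h, Finset.sum_sub_distrib, Finset.sum_add_distrib]
  have h3 : ∑ j, ∑ k, 2 * ((A k k) * star (A j j)).re = 0 := by
    have : ∑ j, ∑ k, ((A k k) * star (A j j)) = 0 := by
      have h4 : ∀ j, ∑ k, ((A k k) * star (A j j)) = 0 := by
        intro j
        rw [← Finset.sum_mul]
        have : ∑ k, A k k = 0 := hT
        rw [this, zero_mul]
      exact Finset.sum_eq_zero fun j _ => h4 j
    have := congrArg Complex.re this
    simp only [Complex.re_sum, Complex.zero_re] at this
    simp only [← Finset.mul_sum, this, mul_zero]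
  rw [h3, norm_sq_mat A]
  simp only [Finset.sum_const, Finset.card_univ, Fintype.card_fin, nsmul_eq_mul]
  rw [← Finset.mul_sum, Finset.sum_comm (f := fun j p => ‖A p j‖ ^ 2)]
  ring

end Frame

section Contract
open scoped Matrix Matrix.Norms.Frobenius
variable {N : ℕ}

lemma norm_exp_mul_sub {X Y : Mat N} (hX : Xᴴ = -X) (hY : Yᴴ = -Y) (d : ℝ) (hd : d ≤ 1 / 2)
    (hXd : ‖X‖ ≤ d) (hYd : ‖Y‖ ≤ d) :
    ‖(eU X : Mat N) * (eU Y : Mat N) - (eU (X + Y) : Mat N)‖ ≤ 8 * d ^ 2 := by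
  have hd0 : 0 ≤ d := (norm_nonneg _).trans hXd
  have hXYn : ‖X + Y‖ ≤ 2 * d := (norm_add_le _ _).trans (by linarith)
  have h1 := norm_exp_sub X (by linarith)
  have h2 := norm_exp_sub Y (by linarith)
  have h3 := norm_exp_sub (X + Y) (by linarith)
  rw [← coe_eU hX] at h1
  rw [← coe_eU hY] at h2
  rw [← coe_eU (skew_add hX hY)] at h3
  set a : Mat N := (eU X : Mat N) with ha
  set b : Mat N := (eU Y : Mat N) with hb
  set c : Mat N := (eU (X + Y) : Mat N) with hc
  have e : a * b - c = (a - 1 - X) * b + (b - 1 - Y) + X * (b - 1 - Y) + X * Y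
      - (c - 1 - (X + Y)) := by noncomm_ring
  have n1 : ‖(a - 1 - X) * b‖ ≤ d ^ 2 := by
    rw [hb, norm_mul_unitary]
    exact h1.trans (pow_le_pow_left₀ (norm_nonneg _) hXd 2)
  have n2 : ‖b - 1 - Y‖ ≤ d ^ 2 := h2.trans (pow_le_pow_left₀ (norm_nonneg _) hYd 2)
  have n3 : ‖X * (b - 1 - Y)‖ ≤ d * d ^ 2 :=
    (norm_mul_le _ _).trans (mul_le_mul hXd n2 (norm_nonneg _) hd0)
  have n4 : ‖X * Y‖ ≤ d * d := (norm_mul_le _ _).trans (mul_le_mul hXd hYd (norm_nonneg _) hd0)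
  have n5 : ‖c - 1 - (X + Y)‖ ≤ (2 * d) ^ 2 := h3.trans (pow_le_pow_left₀ (norm_nonneg _) hXYn 2)
  rw [e]
  refine (norm_sub_le _ _).trans ?_
  have := norm_add_le ((a - 1 - X) * b + (b - 1 - Y) + X * (b - 1 - Y)) (X * Y)
  have := norm_add_le ((a - 1 - X) * b + (b - 1 - Y)) (X * (b - 1 - Y))
  have := norm_add_le ((a - 1 - X) * b) (b - 1 - Y)
  nlinarith

noncomputable def RR (e : ℝ) (a : FI N) (W : UG N) : UG N := W * eU (e • XX a) * W⁻¹

lemma RR_eq (e : ℝ) (a : FI N) (W : UG N) :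
    RR e a W = eU (e • ((W : Mat N) * XX a * ((W⁻¹ : UG N) : Mat N))) := by
  rw [RR, ← eU_conj (skew_smul (XX_skew a) e), Matrix.mul_smul, Matrix.smul_mul]

noncomputable def ZZ (e : ℝ) (A : Mat N) (a : FI N) (W : UG N) : Mat N :=
  (1 / 2 : ℝ) • (((RR e a W)⁻¹ : UG N) : Mat N) * A * (RR e a W : Mat N) + (1 / 2 : ℝ) • A

lemma inv_mul_coe (R : UG N) : ((R⁻¹ : UG N) : Mat N) * (R : Mat N) = 1 := by
  rw [← Submonoid.coe_mul]; simp
lemma mul_inv_coe (R : UG N) : (R : Mat N) * ((R⁻¹ : UG N) : Mat N) = 1 := by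
  rw [← Submonoid.coe_mul]; simp

lemma half_norm (R : UG N) (A : Mat N) :
    ‖(1 / 2 : ℝ) • ((R⁻¹ : UG N) : Mat N) * A * (R : Mat N) + (1 / 2 : ℝ) • A‖ ^ 2
      = ‖A‖ ^ 2 - 1 / 4 * ‖(R : Mat N) * A - A * (R : Mat N)‖ ^ 2 := by
  set B := ((R⁻¹ : UG N) : Mat N) * A * (R : Mat N) with hB
  have e1 : (1 / 2 : ℝ) • ((R⁻¹ : UG N) : Mat N) * A * (R : Mat N) + (1 / 2 : ℝ) • A
      = (1 / 2 : ℝ) • (B + A) := by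
    rw [smul_add, hB, Matrix.smul_mul, Matrix.smul_mul]
  have hBn : ‖B‖ = ‖A‖ := by rw [hB, norm_mul_unitary, norm_unitary_mul]
  have e2 : ‖(R : Mat N) * A - A * (R : Mat N)‖ = ‖B - A‖ := by
    have : (R : Mat N) * (B - A) = A * (R : Mat N) - (R : Mat N) * A := by
      rw [hB, Matrix.mul_sub, ← Matrix.mul_assoc, ← Matrix.mul_assoc, mul_inv_coe, Matrix.one_mul]
    rw [norm_sub_rev, ← this, norm_unitary_mul]
  rw [e1, e2, norm_smul]
  have := parallelogram_mat B A
  rw [hBn] at this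
  norm_num
  nlinarith

lemma comm_lower (e : ℝ) (he0 : 0 ≤ e) (he1 : e ≤ 1) (A : Mat N) (Y : Mat N) (hY : Yᴴ = -Y)
    (hYn : ‖Y‖ ≤ 1) :
    e ^ 2 * ‖Y * A - A * Y‖ ^ 2 - 8 * e ^ 3 * ‖A‖ ^ 2 ≤
      ‖(eU (e • Y) : Mat N) * A - A * (eU (e • Y) : Mat N)‖ ^ 2 := by
  have hn : ‖e • Y‖ ≤ e := by
    rw [norm_smul, Real.norm_eq_abs, abs_of_nonneg he0]; nlinarith [norm_nonneg Y]
  have h1 := norm_exp_sub (e • Y) (hn.trans he1)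
  rw [← coe_eU (skew_smul hY e)] at h1
  set R : Mat N := (eU (e • Y) : Mat N)
  set r := R - 1 - e • Y with hr
  have hrn : ‖r‖ ≤ e ^ 2 := h1.trans (pow_le_pow_left₀ (norm_nonneg _) hn 2)
  have e1 : e • (Y * A - A * Y) = (R * A - A * R) - (r * A - A * r) := by
    rw [hr, smul_sub, ← Matrix.smul_mul, ← Matrix.mul_smul]; noncomm_ring
  have e2 : e * ‖Y * A - A * Y‖ ≤ ‖R * A - A * R‖ + 2 * e ^ 2 * ‖A‖ := by
    calc e * ‖Y * A - A * Y‖ = ‖e • (Y * A - A * Y)‖ := by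
          rw [norm_smul, Real.norm_eq_abs, abs_of_nonneg he0]
      _ ≤ ‖R * A - A * R‖ + ‖r * A - A * r‖ := by rw [e1]; exact norm_sub_le _ _
      _ ≤ ‖R * A - A * R‖ + (‖r‖ * ‖A‖ + ‖A‖ * ‖r‖) := by
          gcongr
          exact (norm_sub_le _ _).trans (add_le_add (norm_mul_le _ _) (norm_mul_le _ _))
      _ ≤ _ := by nlinarith [norm_nonneg A]
  have e3 : ‖Y * A - A * Y‖ ≤ 2 * ‖A‖ := by
    refine (norm_sub_le _ _).trans ?_
    have := norm_mul_le Y A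
    have := norm_mul_le A Y
    nlinarith [norm_nonneg A]
  set u := ‖R * A - A * R‖
  set v := ‖Y * A - A * Y‖
  have hu : 0 ≤ u := norm_nonneg _
  have hv : 0 ≤ v := norm_nonneg _
  have hA := norm_nonneg A
  -- u ≥ e v - w with w = 2 e² ‖A‖
  have hvw : (e * v) * (2 * e ^ 2 * ‖A‖) ≤ 4 * e ^ 3 * ‖A‖ ^ 2 := by
    have : (e * v) * (2 * e ^ 2 * ‖A‖) = (2 * e ^ 3 * ‖A‖) * v := by ring
    rw [this]
    have : 0 ≤ 2 * e ^ 3 * ‖A‖ := by positivity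
    nlinarith
  have hw : 0 ≤ 2 * e ^ 2 * ‖A‖ := by positivity
  have hev : 0 ≤ e * v := by positivity
  by_cases hc : e * v ≤ 2 * e ^ 2 * ‖A‖
  · nlinarith
  · push Not at hc
    nlinarith

lemma sum_ZZ (hN : 0 < N) (e : ℝ) (he0 : 0 ≤ e) (he1 : e ≤ 1 / (16 * N)) (A : Mat N)
    (hA : Aᴴ = -A) (hT : Matrix.trace A = 0) (W : UG N) :
    ∑ a : FI N, ‖ZZ e A a W‖ ^ 2 ≤ (2 * (N : ℝ) ^ 2) * ((1 - e ^ 2 / (8 * N)) * ‖A‖ ^ 2) := by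
  have hN' : (1 : ℝ) ≤ N := by exact_mod_cast hN
  have he2 : e ≤ 1 := he1.trans (by rw [div_le_one (by positivity)]; linarith)
  set B : Mat N := ((W⁻¹ : UG N) : Mat N) * A * (W : Mat N) with hB
  have hB1 : Bᴴ = -B := by
    have := conj_skew hA (W⁻¹); rwa [inv_inv] at this
  have hB2 : Matrix.trace B = 0 := by
    have := conj_trace A (W⁻¹); rw [inv_inv] at this; rw [hB, this, hT]
  have hBn : ‖B‖ = ‖A‖ := by rw [hB, norm_mul_unitary, norm_unitary_mul]
  have hf := frame_comm B hB1 hB2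
  rw [hBn] at hf
  have key : ∀ a : FI N, ‖ZZ e A a W‖ ^ 2 ≤ ‖A‖ ^ 2 -
      1 / 4 * (e ^ 2 * ‖XX a * B - B * XX a‖ ^ 2 - 8 * e ^ 3 * ‖A‖ ^ 2) := by
    intro a
    rw [ZZ, half_norm, RR_eq]
    have h1 := comm_lower e he0 he2 A ((W : Mat N) * XX a * ((W⁻¹ : UG N) : Mat N))
      (conj_skew (XX_skew a) W) (by rw [norm_conj]; exact XX_norm a)
    have h2 : ‖(W : Mat N) * XX a * ((W⁻¹ : UG N) : Mat N) * A
        - A * ((W : Mat N) * XX a * ((W⁻¹ : UG N) : Mat N))‖ = ‖XX a * B - B * XX a‖ := by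
      rw [← norm_conj W (XX a * B - B * XX a)]
      congr 1
      have hA' : A = (W : Mat N) * B * ((W⁻¹ : UG N) : Mat N) := by
        rw [hB]
        simp only [← Matrix.mul_assoc, mul_inv_coe, Matrix.one_mul]
        rw [Matrix.mul_assoc, mul_inv_coe, Matrix.mul_one]
      have hx : ∀ M : Mat N, ((W⁻¹ : UG N) : Mat N) * ((W : Mat N) * M) = M := by
        intro M; rw [← Matrix.mul_assoc, inv_mul_coe, Matrix.one_mul]
      conv_lhs => rw [hA']
      simp only [Matrix.mul_assoc, hx, Matrix.mul_sub, Matrix.sub_mul]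
    rw [h2] at h1
    linarith
  refine (Finset.sum_le_sum fun a _ => key a).trans ?_
  rw [Finset.sum_sub_distrib, ← Finset.mul_sum, Finset.sum_sub_distrib, ← Finset.mul_sum, hf]
  simp only [Finset.sum_const, Finset.card_univ, Fintype.card_prod, Fintype.card_fin,
    Fintype.card_bool, nsmul_eq_mul]
  push_cast
  have h3 : e ^ 3 * (16 * N) ≤ e ^ 2 := by
    rw [le_div_iff₀ (by positivity)] at he1
    nlinarith [sq_nonneg e]
  have h4 : (2 * (N : ℝ) ^ 2) * ((1 - e ^ 2 / (8 * N)) * ‖A‖ ^ 2) =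
    2 * N ^ 2 * ‖A‖ ^ 2 - (N * e ^ 2 / 4) * ‖A‖ ^ 2 := by field_simp; ring
  rw [h4]
  have hA2 : 0 ≤ N * ‖A‖ ^ 2 := by positivity
  nlinarith

lemma avg_ZZ (hN : 0 < N) (e : ℝ) (he0 : 0 ≤ e) (he1 : e ≤ 1 / (16 * N)) (A : Mat N)
    (hA : Aᴴ = -A) (hT : Matrix.trace A = 0) (W : UG N) :
    (2 * (N : ℝ) ^ 2)⁻¹ * ∑ a : FI N, ‖ZZ e A a W‖ ≤ Real.sqrt (1 - e ^ 2 / (8 * N)) * ‖A‖ := by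
  have hN' : (1 : ℝ) ≤ N := by exact_mod_cast hN
  have h := sum_ZZ hN e he0 he1 A hA hT W
  have hcs := sq_sum_le_card_mul_sum_sq (s := Finset.univ) (f := fun a : FI N => ‖ZZ e A a W‖)
  simp only [Finset.card_univ, Fintype.card_prod, Fintype.card_fin, Fintype.card_bool] at hcs
  push_cast at hcs
  set m : ℝ := 2 * (N : ℝ) ^ 2 with hm
  have hm0 : 0 < m := by positivity
  have hq : 0 ≤ 1 - e ^ 2 / (8 * N) := by
    rw [sub_nonneg, div_le_one (by positivity)]
    have : e ≤ 1 := he1.trans (by rw [div_le_one (by positivity)]; linarith)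
    nlinarith
  rw [inv_mul_le_iff₀ hm0]
  refine abs_le_of_sq_le_sq' ?_ (by positivity) |>.2
  have : (N : ℝ) * (N * 2) = m := by rw [hm]; ring
  rw [this] at hcs
  clear_value m
  rw [mul_pow, mul_pow, Real.sq_sqrt hq]
  nlinarith

end Contract

set_option linter.unusedSectionVars false
section Operator
open scoped Matrix Matrix.Norms.Frobenius
variable {N : ℕ}

def FL (L : ℝ) (g : UG N → ℝ) : Prop := ∀ U V : UG N, |g U - g V| ≤ L * ‖(U : Mat N) - (V : Mat N)‖

def GeoL (K : ℝ) (g : UG N → ℝ) : Prop := ∀ (U : UG N) (A : Mat N), Aᴴ = -A → Matrix.trace A = 0 →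
  |g (U * eU A) - g U| ≤ K * ‖A‖

lemma FL.continuous {L : ℝ} {g : UG N → ℝ} (h : FL L g) : Continuous g := by
  have : LipschitzWith L.toNNReal g := by
    apply LipschitzWith.of_dist_le_mul
    intro U V
    rw [Real.dist_eq, Subtype.dist_eq, dist_eq_norm]
    exact (h U V).trans (mul_le_mul_of_nonneg_right (Real.le_coe_toNNReal L) (norm_nonneg _))
  exact this.continuous

lemma eU_zero : (eU (0 : Mat N)) = 1 := by
  apply Subtype.ext
  rw [coe_eU (by simp)]
  simp

lemma eU_smul_succ {A : Mat N} (hA : Aᴴ = -A) (s t : ℝ) :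
    eU ((s + t) • A) = eU (s • A) * eU (t • A) := by
  rw [add_smul, eU_add_of_commute (skew_smul hA s) (skew_smul hA t)]
  exact ((Commute.refl A).smul_left s).smul_right t

lemma GeoL_of_local {K C : ℝ} {g : UG N → ℝ} 
    (h : ∀ (U : UG N) (A : Mat N), Aᴴ = -A → Matrix.trace A = 0 → ‖A‖ ≤ 1 →
      |g (U * eU A) - g U| ≤ K * ‖A‖ + C * ‖A‖ ^ 2) : GeoL K g := by
  intro U A hA hT
  have key : ∀ n : ℕ, ‖A‖ ≤ n → 0 < n →
      |g (U * eU A) - g U| ≤ K * ‖A‖ + C * ‖A‖ ^ 2 * (1 / (n : ℝ)) := by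
    intro n hn hn0
    have hn0' : (0 : ℝ) < n := by exact_mod_cast hn0
    have hstep : ∀ k : ℕ, |g (U * eU ((k * (1 / (n : ℝ))) • A)) - g U| ≤
        k * (K * (‖A‖ / n) + C * (‖A‖ / n) ^ 2) := by
      intro k
      induction k with
      | zero => simp [eU_zero]
      | succ k ih =>
        push_cast
        rw [add_mul, one_mul, eU_smul_succ hA, ← mul_assoc]
        have hnn : ‖(1 / (n : ℝ)) • A‖ = ‖A‖ / n := by
          rw [norm_smul, Real.norm_eq_abs, abs_of_pos (by positivity)]; ring
        have h1 := h (U * eU ((k * (1 / (n : ℝ))) • A)) ((1 / (n : ℝ)) • A) (skew_smul hA _)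
          (by rw [Matrix.trace_smul, hT, smul_zero])
          (by rw [hnn, div_le_one hn0']; exact hn)
        rw [hnn] at h1
        have := abs_sub_le (g (U * eU ((k * (1 / (n : ℝ))) • A) * eU ((1 / (n : ℝ)) • A)))
          (g (U * eU ((k * (1 / (n : ℝ))) • A))) (g U)
        linarith
    have := hstep n
    rw [mul_one_div_cancel hn0'.ne', one_smul] at this
    refine this.trans (le_of_eq ?_)
    field_simp
  have lim : Filter.Tendsto (fun n : ℕ => K * ‖A‖ + C * ‖A‖ ^ 2 * (1 / (n : ℝ))) Filter.atTop
      (nhds (K * ‖A‖ + C * ‖A‖ ^ 2 * 0)) :=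
    (tendsto_one_div_atTop_nhds_zero_nat.const_mul _).const_add _
  have := ge_of_tendsto lim (b := |g (U * eU A) - g U|) (by
    filter_upwards [Filter.eventually_ge_atTop ⌈‖A‖⌉₊, Filter.eventually_gt_atTop 0] with n h1 h2
    exact key n (Nat.ceil_le.1 h1) h2)
  simpa using this

/-- average over the frame -/
noncomputable def av (F : FI N → ℝ) : ℝ := (2 * (N : ℝ) ^ 2)⁻¹ * ∑ a, F a

lemma av_const (hN : 0 < N) (c : ℝ) : av (fun _ : FI N => c) = c := by
  have : (N : ℝ) ≠ 0 := by positivity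
  simp [av]
  field_simp

lemma av_mono {F G : FI N → ℝ} (h : ∀ a, F a ≤ G a) : av F ≤ av G :=
  mul_le_mul_of_nonneg_left (Finset.sum_le_sum fun a _ => h a) (by positivity)

lemma av_add (F G : FI N → ℝ) : av (fun a => F a + G a) = av F + av G := by
  simp only [av, Finset.sum_add_distrib, mul_add]

lemma av_sub (F G : FI N → ℝ) : av (fun a => F a - G a) = av F - av G := by
  simp only [av, Finset.sum_sub_distrib, mul_sub]

lemma av_smul (c : ℝ) (F : FI N → ℝ) : av (fun a => c * F a) = c * av F := by
  simp only [av, ← Finset.mul_sum]; ring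

lemma av_abs (F : FI N → ℝ) : |av F| ≤ av (fun a => |F a|) := by
  rw [av, av, abs_mul, abs_of_nonneg (by positivity : (0 : ℝ) ≤ (2 * (N : ℝ) ^ 2)⁻¹)]
  exact mul_le_mul_of_nonneg_left (Finset.abs_sum_le_sum_abs _ _) (by positivity)

lemma continuous_av {T : Type*} [TopologicalSpace T] {F : T → FI N → ℝ}
    (h : ∀ a, Continuous fun t => F t a) : Continuous fun t => av (F t) := by
  unfold av
  exact continuous_const.mul (continuous_finsetSum _ fun a _ => h a)

lemma continuous_RR (e : ℝ) (a : FI N) : Continuous (fun W : UG N => RR e a W) := by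
  unfold RR
  fun_prop

variable [MeasurableSpace (UG N)] [BorelSpace (UG N)] (μ : Measure (UG N)) [IsProbabilityMeasure μ]

noncomputable def Pop (e : ℝ) (g : UG N → ℝ) (U : UG N) : ℝ :=
  ∫ W, av (fun a => g (U * RR e a W)) ∂μ

lemma cont_int {F : UG N → ℝ} (h : Continuous F) : Integrable F μ :=
  h.integrable_of_hasCompactSupport (HasCompactSupport.of_compactSpace F)

lemma int_le_const {F : UG N → ℝ} (h : Continuous F) (c : ℝ) (hc : ∀ W, F W ≤ c) :
    ∫ W, F W ∂μ ≤ c := by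
  have := integral_mono (cont_int μ h) (integrable_const c) hc
  simpa using this

lemma abs_int_le {F : UG N → ℝ} (c : ℝ) (hc : ∀ W, |F W| ≤ c) :
    |∫ W, F W ∂μ| ≤ c := by
  have := norm_integral_le_of_norm_le_const (μ := μ) (f := F) (C := c) (Filter.Eventually.of_forall hc)
  simpa using this

lemma cont_avR {g : UG N → ℝ} (hg : Continuous g) (e : ℝ) (U : UG N) :
    Continuous fun W => av (fun a => g (U * RR e a W)) :=
  continuous_av fun a => hg.comp (continuous_const.mul (continuous_RR e a))

lemma Pop_sub {g h : UG N → ℝ} (hg : Continuous g) (hh : Continuous h) (e : ℝ) (U V : UG N) :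
    Pop μ e g U - Pop μ e h V = ∫ W, (av fun a => g (U * RR e a W) - h (V * RR e a W)) ∂μ := by
  simp only [av_sub]
  exact (integral_sub (cont_int μ (cont_avR hg e U)) (cont_int μ (cont_avR hh e V))).symm

lemma FL_Pop (hN : 0 < N) {L : ℝ} {g : UG N → ℝ} (h : FL L g) (e : ℝ) : FL L (Pop μ e g) := by
  intro U V
  rw [Pop_sub μ h.continuous h.continuous]
  apply abs_int_le
  intro W
  refine (av_abs _).trans ?_
  refine (av_mono (G := fun _ => L * ‖(U : Mat N) - (V : Mat N)‖) fun a => ?_).trans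
    (av_const hN _).le
  refine (h _ _).trans (le_of_eq ?_)
  rw [Submonoid.coe_mul, Submonoid.coe_mul, ← sub_mul, norm_mul_unitary]

lemma GeoL_Pop (hN : 0 < N) (hH : ∀ g : UG N, MeasurePreserving (fun x => g * x) μ μ)
    {L K : ℝ} {g : UG N → ℝ} (h : FL L g) (hK : GeoL K g) (hK0 : 0 ≤ K) (hL0 : 0 ≤ L)
    (e : ℝ) (he0 : 0 ≤ e) (he1 : e ≤ 1 / (16 * N)) :
    GeoL (K * Real.sqrt (1 - e ^ 2 / (8 * N))) (Pop μ e g) := by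
  apply GeoL_of_local (C := 2 * L)
  intro U A hA hT hA1
  set k : UG N := eU ((1 / 2 : ℝ) • A) with hk
  have hkk : eU A = k * k := by
    rw [hk, ← eU_smul_succ hA]; norm_num
  have e1 : Pop μ e g (U * eU A) = ∫ W, av (fun a => g (U * k * RR e a W * k)) ∂μ := by
    rw [Pop, ← (hH k⁻¹).integral_comp (Homeomorph.mulLeft k⁻¹).measurableEmbedding]
    congr 1; ext W; congr 1; ext a; congr 1
    rw [hkk, RR, RR]; group
  have e2 : Pop μ e g (U * eU A) - Pop μ e g U
      = ∫ W, av (fun a => g (U * k * RR e a W * k) - g (U * RR e a W)) ∂μ := by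
    rw [e1]
    simp only [av_sub]
    refine (integral_sub (cont_int μ ?_) (cont_int μ (cont_avR h.continuous e U))).symm
    exact continuous_av fun a => h.continuous.comp
      ((continuous_const.mul (continuous_RR e a)).mul continuous_const)
  rw [e2]
  apply abs_int_le
  intro W
  refine (av_abs _).trans ?_
  have hA2 : ‖(1 / 2 : ℝ) • A‖ = ‖A‖ / 2 := by
    rw [norm_smul, Real.norm_eq_abs, abs_of_pos (by positivity)]; ring
  have hs := skew_smul hA (1 / 2)
  have pt : ∀ a, |g (U * k * RR e a W * k) - g (U * RR e a W)| ≤ K * ‖ZZ e A a W‖ + 2 * L * ‖A‖ ^ 2 := by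
    intro a
    set R := RR e a W with hR
    set Y : Mat N := ((R⁻¹ : UG N) : Mat N) * ((1 / 2 : ℝ) • A) * (((R⁻¹)⁻¹ : UG N) : Mat N) with hY
    have hYs : Yᴴ = -Y := conj_skew hs R⁻¹
    have hZ : ZZ e A a W = Y + (1 / 2 : ℝ) • A := by
      rw [ZZ, hY, ← hR, inv_inv, Matrix.mul_smul, Matrix.smul_mul]
    have hZs : (ZZ e A a W)ᴴ = - ZZ e A a W := by rw [hZ]; exact skew_add hYs hs
    have hZt : Matrix.trace (ZZ e A a W) = 0 := by
      rw [hZ, Matrix.trace_add, hY, conj_trace, Matrix.trace_smul, hT]; simp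
    have eq : U * k * R * k = U * R * (eU Y * eU ((1 / 2 : ℝ) • A)) := by
      rw [hY, eU_conj hs, ← hk]; group
    have b1 : |g (U * R * (eU Y * eU ((1 / 2 : ℝ) • A))) - g (U * R * eU (ZZ e A a W))|
        ≤ L * (2 * ‖A‖ ^ 2) := by
      refine (h _ _).trans (mul_le_mul_of_nonneg_left ?_ hL0)
      have ed : ((U * R * (eU Y * eU ((1 / 2 : ℝ) • A)) : UG N) : Mat N)
          - ((U * R * eU (ZZ e A a W) : UG N) : Mat N)
          = ((U * R : UG N) : Mat N) * ((eU Y : Mat N) * (eU ((1 / 2 : ℝ) • A) : Mat N)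
            - (eU (ZZ e A a W) : Mat N)) := by
        rw [mul_sub]; rfl
      rw [ed, norm_unitary_mul, hZ]
      refine (norm_exp_mul_sub hYs hs (‖A‖ / 2) (by linarith) ?_ hA2.le).trans (by nlinarith)
      rw [hY, norm_conj, hA2]
    have b2 := hK (U * R) (ZZ e A a W) hZs hZt
    rw [eq]
    have := abs_sub_le (g (U * R * (eU Y * eU ((1 / 2 : ℝ) • A)))) (g (U * R * eU (ZZ e A a W)))
      (g (U * R))
    linarith
  refine (av_mono pt).trans ?_
  rw [av_add, av_smul, av_const hN]
  have := mul_le_mul_of_nonneg_left (avg_ZZ hN e he0 he1 A hA hT W) hK0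
  unfold av
  linarith

lemma GeoL_of_FL {L : ℝ} (hL : 0 ≤ L) {g : UG N → ℝ} (h : FL L g) : GeoL L g := by
  apply GeoL_of_local (C := L)
  intro U A hA _ h1
  refine (h _ _).trans ?_
  have : ((U * eU A : UG N) : Mat N) - (U : Mat N) = (U : Mat N) * (NormedSpace.exp A - 1 - A + A) := by
    rw [Submonoid.coe_mul, coe_eU hA]; noncomm_ring
  rw [this, norm_unitary_mul]
  have := norm_add_le (NormedSpace.exp A - 1 - A) A
  have := norm_exp_sub A h1
  nlinarith

end Operator

set_option linter.unusedSectionVars false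
instance instSCMat (N : ℕ) : SecondCountableTopology (Mat N) :=
  inferInstanceAs (SecondCountableTopology (Fin N → Fin N → ℂ))

instance instSCUG (N : ℕ) : SecondCountableTopology (UG N) :=
  Topology.IsEmbedding.subtypeVal.secondCountableTopology

instance instLCMat (N : ℕ) : LocallyCompactSpace (Mat N) :=
  inferInstanceAs (LocallyCompactSpace (Fin N → Fin N → ℂ))

section Mgf
open scoped Matrix Matrix.Norms.Frobenius
variable {N : ℕ}

def Diff1 (C : ℝ) (g : UG N → ℝ) : Prop := ∃ l : UG N → Mat N →ₗ[ℝ] ℝ,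
  Continuous (fun p : UG N × Mat N => l p.1 p.2) ∧
  ∀ (U : UG N) (X : Mat N), Xᴴ = -X → ‖X‖ ≤ 1 → |g (U * eU X) - g U - l U X| ≤ C * ‖X‖ ^ 2

lemma deriv_bound {K C : ℝ} {g : UG N → ℝ} (hK : GeoL K g) (l : Mat N →ₗ[ℝ] ℝ) (U : UG N)
    (hl : ∀ (X : Mat N), Xᴴ = -X → ‖X‖ ≤ 1 → |g (U * eU X) - g U - l X| ≤ C * ‖X‖ ^ 2)
    (X : Mat N) (hX : Xᴴ = -X) (hT : Matrix.trace X = 0) : |l X| ≤ K * ‖X‖ := by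
  have key : ∀ n : ℕ, ‖X‖ ≤ n → 0 < n → |l X| ≤ K * ‖X‖ + C * ‖X‖ ^ 2 * (1 / (n : ℝ)) := by
    intro n hn hn0
    have hn0' : (0 : ℝ) < n := by exact_mod_cast hn0
    have hnn : ‖(1 / (n : ℝ)) • X‖ = ‖X‖ / n := by
      rw [norm_smul, Real.norm_eq_abs, abs_of_pos (by positivity)]; ring
    have h1 := hl ((1 / (n : ℝ)) • X) (skew_smul hX _)
          (by rw [hnn, div_le_one hn0']; exact hn)
    have h2 := hK U ((1 / (n : ℝ)) • X) (skew_smul hX _)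
      (by rw [Matrix.trace_smul, hT, smul_zero])
    rw [hnn] at h1 h2
    have h3 : |l ((1 / (n : ℝ)) • X)| ≤ K * (‖X‖ / n) + C * (‖X‖ / n) ^ 2 := by
      rw [abs_le] at h1 h2 ⊢
      constructor <;> linarith [h1.1, h1.2, h2.1, h2.2]
    rw [map_smul, smul_eq_mul, abs_mul, abs_of_pos (by positivity : (0 : ℝ) < 1 / n)] at h3
    have h4 : |l X| = n * (1 / n * |l X|) := by field_simp
    rw [h4]
    refine (mul_le_mul_of_nonneg_left h3 hn0'.le).trans (le_of_eq ?_)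
    field_simp
  have lim : Filter.Tendsto (fun n : ℕ => K * ‖X‖ + C * ‖X‖ ^ 2 * (1 / (n : ℝ))) Filter.atTop
      (nhds (K * ‖X‖ + C * ‖X‖ ^ 2 * 0)) :=
    (tendsto_one_div_atTop_nhds_zero_nat.const_mul _).const_add _
  have := ge_of_tendsto lim (b := |l X|) (by
    filter_upwards [Filter.eventually_ge_atTop ⌈‖X‖⌉₊, Filter.eventually_gt_atTop 0] with n h1 h2
    exact key n (Nat.ceil_le.1 h1) h2)
  simpa using this

lemma frame_deriv (hN : 0 < N) {K : ℝ} (l : Mat N →ₗ[ℝ] ℝ)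
    (hl : ∀ X : Mat N, Xᴴ = -X → Matrix.trace X = 0 → |l X| ≤ K * ‖X‖) (W : UG N) :
    ∑ a : FI N, (l ((W : Mat N) * XX a * ((W⁻¹ : UG N) : Mat N))) ^ 2 ≤ K ^ 2 := by
  set c : FI N → ℝ := fun a => l ((W : Mat N) * XX a * ((W⁻¹ : UG N) : Mat N)) with hc
  set V : Mat N := ∑ a, c a • XX a with hV
  set S := ∑ a, c a ^ 2 with hS
  have hS0 : 0 ≤ S := Finset.sum_nonneg fun a _ => sq_nonneg _
  have hVs : Vᴴ = -V := by
    rw [hV, Matrix.conjTranspose_sum, ← Finset.sum_neg_distrib]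
    exact Finset.sum_congr rfl fun a _ => skew_smul (XX_skew a) _
  have hVt : Matrix.trace V = 0 := by
    rw [hV, Matrix.trace_sum]
    exact Finset.sum_eq_zero fun a _ => by rw [Matrix.trace_smul, XX_trace hN, smul_zero]
  have hSl : l ((W : Mat N) * V * ((W⁻¹ : UG N) : Mat N)) = S := by
    rw [hV, Finset.mul_sum, Finset.sum_mul, map_sum, hS]
    refine Finset.sum_congr rfl fun a _ => ?_
    rw [Matrix.mul_smul, Matrix.smul_mul, map_smul, smul_eq_mul, sq]
  have h1 := hl _ (conj_skew hVs W) (by rw [conj_trace, hVt])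
  rw [hSl, norm_conj, abs_of_nonneg hS0] at h1
  have h2 : ‖V‖ ^ 2 ≤ S := frame_sum c
  have h3 : S ^ 2 ≤ K ^ 2 * S := by
    have := pow_le_pow_left₀ hS0 h1 2
    rw [mul_pow] at this
    exact this.trans (mul_le_mul_of_nonneg_left h2 (sq_nonneg _))
  by_contra hcon
  push Not at hcon
  have : 0 < S := lt_of_le_of_lt (sq_nonneg _) hcon
  nlinarith

lemma exp_le_cubic (d : ℝ) (hd : |d| ≤ 1) : Real.exp d ≤ 1 + d + d ^ 2 / 2 + |d| ^ 3 := by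
  have := Real.exp_bound hd (n := 3) (by norm_num)
  have h2 := (abs_le.1 this).2
  simp [Finset.sum_range_succ, Nat.factorial] at h2
  have : 0 ≤ |d| ^ 3 := by positivity
  nlinarith

variable [MeasurableSpace (UG N)] [BorelSpace (UG N)] (μ : Measure (UG N)) [IsProbabilityMeasure μ]

lemma Pop_exp_le (hN : 0 < N) {L K C : ℝ} {g : UG N → ℝ} (h : FL L g) (hK : GeoL K g)
    (hK0 : 0 ≤ K) (hKL : K ≤ L) (hC : 0 ≤ C) (hD : Diff1 C g)
    (e : ℝ) (he0 : 0 ≤ e) (he1 : e ≤ 1) (heL : L * e ≤ 1) (U : UG N) :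
    Pop μ e (fun V => Real.exp (g V)) U ≤
      Real.exp (Pop μ e g U + (e ^ 2 * K ^ 2 / (4 * (N : ℝ) ^ 2) + (L * C + C ^ 2 + L ^ 3) * e ^ 3)) := by
  obtain ⟨l, hlc, hl⟩ := hD
  set B := e ^ 2 * K ^ 2 / (4 * (N : ℝ) ^ 2) + (L * C + C ^ 2 + L ^ 3) * e ^ 3 with hB
  have hlK := deriv_bound hK (l U) U (hl U)
  have hgc := h.continuous
  have pt : ∀ W, av (fun a => Real.exp (g (U * RR e a W))) ≤
      Real.exp (g U) * (1 + (av (fun a => g (U * RR e a W)) - g U) + B) := by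
    intro W
    set Y : FI N → Mat N := fun a => (W : Mat N) * XX a * ((W⁻¹ : UG N) : Mat N) with hY
    have hYs : ∀ a, (Y a)ᴴ = - Y a := fun a => conj_skew (XX_skew a) W
    have hYt : ∀ a, Matrix.trace (Y a) = 0 := fun a => by rw [hY]; simp only; rw [conj_trace, XX_trace hN]
    have hYn : ∀ a, ‖Y a‖ ≤ 1 := fun a => by rw [hY]; simp only; rw [norm_conj]; exact XX_norm a
    have hR : ∀ a, RR e a W = eU (e • Y a) := fun a => RR_eq e a W
    have heY : ∀ a, ‖e • Y a‖ ≤ e := fun a => by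
      rw [norm_smul, Real.norm_eq_abs, abs_of_nonneg he0]
      exact mul_le_of_le_one_right he0 (hYn a)
    have hs := frame_deriv hN (l U) hlK W
    have pa : ∀ a, Real.exp (g (U * RR e a W)) ≤ Real.exp (g U) * (1 + (g (U * RR e a W) - g U) +
        (e ^ 2 / 2 * (l U (Y a)) ^ 2 + (L * C + C ^ 2 + L ^ 3) * e ^ 3)) := by
      intro a
      set d := g (U * RR e a W) - g U with hd
      have e1 : Real.exp (g (U * RR e a W)) = Real.exp (g U) * Real.exp d := by
        rw [← Real.exp_add, hd]; ring_nf
      rw [e1]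
      refine mul_le_mul_of_nonneg_left ?_ (Real.exp_pos _).le
      have hd1 : |d| ≤ K * e := by
        have := hK U (e • Y a) (skew_smul (hYs a) e) (by rw [Matrix.trace_smul, hYt, smul_zero])
        rw [← hR] at this
        exact this.trans (mul_le_mul_of_nonneg_left (heY a) hK0)
      have hd2 : |d| ≤ L * e := hd1.trans (mul_le_mul_of_nonneg_right hKL he0)
      have hr := hl U (e • Y a) (skew_smul (hYs a) e) ((heY a).trans he1)
      rw [← hR, map_smul, smul_eq_mul, ← hd] at hr
      set y := l U (Y a) with hy
      have hyK : |y| ≤ L := ((hlK _ (hYs a) (hYt a)).trans (mul_le_of_le_one_right hK0 (hYn a))).trans hKL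
      have hr2 : |d - e * y| ≤ C * e ^ 2 :=
        hr.trans (mul_le_mul_of_nonneg_left (pow_le_pow_left₀ (norm_nonneg _) (heY a) 2) hC)
      have hL0 := hK0.trans hKL
      have hc := exp_le_cubic d (hd2.trans heL)
      have h3 : |d| ^ 3 ≤ L ^ 3 * e ^ 3 := by
        rw [← mul_pow]; exact pow_le_pow_left₀ (abs_nonneg _) hd2 3
      have h4 : d ^ 2 ≤ e ^ 2 * y ^ 2 + 2 * (e * L * (C * e ^ 2)) + C ^ 2 * e ^ 3 := by
        have hdd : d ^ 2 = e ^ 2 * y ^ 2 + 2 * ((e * y) * (d - e * y)) + (d - e * y) ^ 2 := by ring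
        have i1 : (e * y) * (d - e * y) ≤ e * L * (C * e ^ 2) := by
          refine (le_abs_self _).trans ?_
          rw [abs_mul, abs_mul, abs_of_nonneg he0]
          exact mul_le_mul (mul_le_mul_of_nonneg_left hyK he0) hr2 (abs_nonneg _) (by positivity)
        have i2 : (d - e * y) ^ 2 ≤ C ^ 2 * e ^ 3 := by
          rw [← sq_abs]
          refine (pow_le_pow_left₀ (abs_nonneg _) hr2 2).trans ?_
          have : e ^ 4 ≤ e ^ 3 := pow_le_pow_of_le_one he0 he1 (by norm_num)
          nlinarith [sq_nonneg C]
        linarith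
      have h5 : 0 ≤ C ^ 2 * e ^ 3 := by positivity
      linarith
    refine (av_mono pa).trans ?_
    rw [av_smul, av_add, av_add, av_add, av_const hN, av_const hN, av_sub, av_const hN, av_smul]
    refine mul_le_mul_of_nonneg_left ?_ (Real.exp_pos _).le
    have : av (fun a => (l U (Y a)) ^ 2) ≤ K ^ 2 / (2 * (N : ℝ) ^ 2) := by
      rw [av, inv_mul_eq_div]
      exact div_le_div_of_nonneg_right hs (by positivity)
    have h6 := mul_le_mul_of_nonneg_left this (by positivity : 0 ≤ e ^ 2 / 2)
    have h7 : e ^ 2 / 2 * (K ^ 2 / (2 * (N : ℝ) ^ 2)) = e ^ 2 * K ^ 2 / (4 * (N : ℝ) ^ 2) := by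
      ring
    rw [hB]
    linarith
  have hint : Pop μ e (fun V => Real.exp (g V)) U ≤
      ∫ W, Real.exp (g U) * (1 + (av (fun a => g (U * RR e a W)) - g U) + B) ∂μ := by
    refine integral_mono (cont_int μ (cont_avR (Real.continuous_exp.comp hgc) e U)) (cont_int μ ?_) pt
    exact continuous_const.mul ((continuous_const.add
      ((cont_avR hgc e U).sub continuous_const)).add continuous_const)
  refine hint.trans ?_
  have hi := cont_int μ (cont_avR hgc e U)
  rw [integral_const_mul, integral_add, integral_add, integral_sub hi (integrable_const _)]
  · simp only [integral_const, probReal_univ, one_smul]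
    have : Pop μ e g U = ∫ W, av (fun a => g (U * RR e a W)) ∂μ := rfl
    rw [← this]
    have e1 : Pop μ e g U + B = g U + (Pop μ e g U - g U + B) := by ring
    rw [e1, Real.exp_add]
    refine mul_le_mul_of_nonneg_left ?_ (Real.exp_pos _).le
    have := Real.add_one_le_exp (Pop μ e g U - g U + B)
    linarith
  · exact integrable_const _
  · exact hi.sub (integrable_const _)
  · exact (integrable_const _).add (hi.sub (integrable_const _))
  · exact integrable_const _

noncomputable def lF (l : UG N → Mat N →ₗ[ℝ] ℝ) (e : ℝ) (p : UG N × Mat N) (W : UG N) : ℝ := av fun a =>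
    l (p.1 * RR e a W) ((((RR e a W)⁻¹ : UG N) : Mat N) * p.2 * ((((RR e a W)⁻¹)⁻¹ : UG N) : Mat N))

lemma lF_cont {l : UG N → Mat N →ₗ[ℝ] ℝ} (hlc : Continuous (fun p : UG N × Mat N => l p.1 p.2)) 
    (e : ℝ) : Continuous (lF l e).uncurry := by
    apply continuous_av
    intro a
    have hR : Continuous fun p : (UG N × Mat N) × UG N => RR e a p.2 :=
      (continuous_RR e a).comp continuous_snd
    have h1 : Continuous fun p : (UG N × Mat N) × UG N =>
      (p.1.1 * RR e a p.2, (((RR e a p.2)⁻¹ : UG N) : Mat N) * p.1.2 *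
        ((((RR e a p.2)⁻¹)⁻¹ : UG N) : Mat N)) := by
      refine (continuous_fst.fst.mul hR).prodMk ?_
      exact ((continuous_subtype_val.comp hR.inv).mul continuous_fst.snd).mul
        (continuous_subtype_val.comp hR.inv.inv)
    exact hlc.comp h1

lemma lF_int {l : UG N → Mat N →ₗ[ℝ] ℝ} (hlc : Continuous (fun p : UG N × Mat N => l p.1 p.2)) 
    (e : ℝ) (p : UG N × Mat N) : Integrable (lF l e p) μ := by
  apply cont_int
  have h1 : Continuous fun W : UG N => ((p, W) : (UG N × Mat N) × UG N) :=
    continuous_const.prodMk continuous_id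
  have h2 : lF l e p = (lF l e).uncurry ∘ fun W : UG N => ((p, W) : (UG N × Mat N) × UG N) := rfl
  rw [h2]
  exact (lF_cont hlc e).comp h1

noncomputable def lP {l : UG N → Mat N →ₗ[ℝ] ℝ} (hlc : Continuous (fun p : UG N × Mat N => l p.1 p.2)) 
    (e : ℝ) (U : UG N) : Mat N →ₗ[ℝ] ℝ where
  toFun X := ∫ W, lF l e (U, X) W ∂μ
  map_add' X Y := by
    rw [← integral_add (lF_int μ hlc e _) (lF_int μ hlc e _)]
    congr 1; ext W
    simp only [lF, mul_add, add_mul, map_add, av_add]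
  map_smul' c X := by
    rw [RingHom.id_apply, smul_eq_mul, ← integral_const_mul]
    congr 1; ext W
    simp only [lF, Matrix.mul_smul, Matrix.smul_mul, map_smul, smul_eq_mul, av_smul]

lemma Diff1_Pop (hN : 0 < N) {C : ℝ} {g : UG N → ℝ} (hgc : Continuous g) (hD : Diff1 C g) (e : ℝ) :
    Diff1 C (Pop μ e g) := by
  obtain ⟨l, hlc, hl⟩ := hD
  refine ⟨lP μ hlc e, ?_, ?_⟩
  · have h1 := continuous_parametric_integral_of_continuous (μ := μ) (lF_cont hlc e) isCompact_univ
    simp only [Measure.restrict_univ] at h1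
    exact h1
  · intro U X hX hX1
    have h0 : lP μ hlc e U X = ∫ W, lF l e (U, X) W ∂μ := rfl
    rw [h0, Pop_sub μ hgc hgc, ← integral_sub _ (lF_int μ hlc e _)]
    · apply abs_int_le
      intro W
      rw [lF, ← av_sub]
      refine (av_abs _).trans ?_
      refine (av_mono (G := fun _ => C * ‖X‖ ^ 2) fun a => ?_).trans (av_const hN _).le
      set R := RR e a W
      have h1 := hl (U * R) _ (conj_skew hX R⁻¹) (by rw [norm_conj]; exact hX1)
      rw [norm_conj, eU_conj hX] at h1
      have : U * R * (R⁻¹ * eU X * R⁻¹⁻¹) = U * eU X * R := by group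
      rwa [this] at h1
    · simp only [av_sub]
      exact (cont_int μ (cont_avR hgc e _)).sub (cont_int μ (cont_avR hgc e _))

lemma int_Pop (hN : 0 < N) (hH : ∀ g : UG N, MeasurePreserving (fun x => g * x) μ μ)
    {g : UG N → ℝ} (hg : Continuous g) (e : ℝ) : ∫ U, Pop μ e g U ∂μ = ∫ U, g U ∂μ := by
  have : μ.IsMulLeftInvariant := ⟨fun x => (hH x).map_eq⟩
  have : μ.IsHaarMeasure := Measure.isHaarMeasure_of_isCompact_nonempty_interior μ Set.univ
    isCompact_univ (by simp) (by simp) (by simp)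
  have hr : μ.IsMulRightInvariant := by
    refine ⟨fun q => ?_⟩
    have hm : Measurable fun x : UG N => x * q := (continuous_mul_const q).measurable
    have : (Measure.map (fun x => x * q) μ).IsMulLeftInvariant := by
      refine ⟨fun g => ?_⟩
      rw [Measure.map_map (continuous_const_mul g).measurable hm]
      conv_rhs => rw [← (hH g).map_eq]
      rw [Measure.map_map hm (continuous_const_mul g).measurable]
      congr 1; ext x : 1; simp [mul_assoc]
    have hp : IsProbabilityMeasure (Measure.map (fun x => x * q) μ) :=
      Measure.isProbabilityMeasure_map hm.aemeasurable
    have h1 := Measure.isMulInvariant_eq_smul_of_compactSpace (Measure.map (fun x => x * q) μ) μ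
    have h2 := congrArg (fun ν : Measure (UG N) => ν Set.univ) h1
    simp only [measure_univ, Measure.smul_apply] at h2
    have h3 : Measure.haarScalarFactor (Measure.map (fun x => x * q) μ) μ = 1 := by
      rw [ENNReal.smul_def] at h2
      simpa using h2.symm
    rw [h1, h3, one_smul]
  unfold Pop
  have hc : Continuous (Function.uncurry fun U W => av (fun a => g (U * RR e a W))) := by
    apply continuous_av
    intro a
    exact hg.comp (continuous_fst.mul ((continuous_RR e a).comp continuous_snd))
  have hI : Integrable (Function.uncurry fun U W => av (fun a => g (U * RR e a W))) (μ.prod μ) :=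
    hc.integrable_of_hasCompactSupport (HasCompactSupport.of_compactSpace _)
  rw [integral_integral_swap hI]
  have : ∀ W, ∫ U, av (fun a => g (U * RR e a W)) ∂μ = ∫ U, g U ∂μ := by
    intro W
    unfold av
    rw [integral_const_mul, integral_finsetSum]
    · simp only [integral_mul_right_eq_self (μ := μ) g]
      exact av_const hN _
    · intro a _
      exact cont_int μ (hg.comp (continuous_id.mul continuous_const))
  simp [this]

end Mgf

section LogAbs
open Complex NormedSpace selfAdjoint Unitary in
lemma exists_log_unitary {A : Type*} [CStarAlgebra A] (u : unitary A)
    (hf : (spectrum ℂ (u : A)).Finite) :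
    ∃ H : A, star H = H ∧ ‖H‖ ≤ Real.pi ∧ NormedSpace.exp (I • H) = (u : A) := by
  refine ⟨argSelfAdjoint u, (argSelfAdjoint u).2, Unitary.norm_argSelfAdjoint_le_pi u, ?_⟩
  have : ContinuousOn arg (spectrum ℂ (u : A)) := hf.continuousOn _
  rw [argSelfAdjoint_coe, ← CFC.exp_eq_normedSpace_exp (𝕜 := ℂ),
    ← cfc_comp_smul .., ← cfc_comp' ..]
  conv_rhs => rw [← cfc_id' ℂ (u : A)]
  refine cfc_congr fun y hy ↦ ?_
  have hy₁ : ‖y‖ = 1 := spectrum.norm_eq_one_of_unitary u.2 hy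
  have : I * y.arg = log y :=
    Complex.ext (by simp [log_re, spectrum.norm_eq_one_of_unitary u.2 hy]) (by simp [log_im])
  simpa [← exp_eq_exp_ℂ, this] using exp_log (by aesop)

end LogAbs

section LogMat
open scoped Matrix Matrix.Norms.L2Operator

lemma entry_le_l2 {N : ℕ} (A : Mat N) (i j : Fin N) : ‖A i j‖ ≤ ‖A‖ := by
  have h := Matrix.l2_opNorm_mulVec A (EuclideanSpace.single j (1 : ℂ))
  rw [EuclideanSpace.norm_single, norm_one, mul_one] at h
  refine le_trans ?_ h
  refine le_trans (le_of_eq ?_) (PiLp.norm_apply_le _ i)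
  simp

lemma exists_log_mat {N : ℕ} (W : UG N) : ∃ H : Mat N, Hᴴ = H ∧ (∀ i j, ‖H i j‖ ≤ Real.pi) ∧
    NormedSpace.exp (Complex.I • H) = (W : Mat N) := by
  obtain ⟨H, h1, h2, h3⟩ := exists_log_unitary (A := Mat N) W (Matrix.finite_spectrum _)
  exact ⟨H, h1, fun i j => (entry_le_l2 H i j).trans h2, h3⟩

end LogMat

section Osc
open scoped Matrix Matrix.Norms.Frobenius
variable {N : ℕ}

lemma norm_le_of_entries (A : Mat N) (c : ℝ) (hc : 0 ≤ c) (h : ∀ i j, ‖A i j‖ ≤ c) :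
    ‖A‖ ≤ N * c := by
  refine abs_le_of_sq_le_sq' ?_ (by positivity) |>.2
  rw [norm_sq_mat]
  calc ∑ i, ∑ j, ‖A i j‖ ^ 2 ≤ ∑ _i : Fin N, ∑ _j : Fin N, c ^ 2 :=
        Finset.sum_le_sum fun i _ => Finset.sum_le_sum fun j _ =>
          pow_le_pow_left₀ (norm_nonneg _) (h i j) 2
    _ = (N * c) ^ 2 := by simp; ring

lemma norm_one_sq : ‖(1 : Mat N)‖ ^ 2 = N := by
  rw [norm_sq_trace]; simp

lemma exp_dconst (X : Mat N) (z : ℂ) :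
    NormedSpace.exp (X + Matrix.diagonal (fun _ => z)) = Complex.exp z • NormedSpace.exp X := by
  have hc : Commute X (Matrix.diagonal (fun _ => z)) := by
    rw [Commute, SemiconjBy, ← Matrix.smul_one_eq_diagonal]; simp
  rw [Matrix.exp_add_of_commute _ _ hc, Matrix.exp_diagonal]
  have : (NormedSpace.exp (fun _ : Fin N => z)) = fun _ => Complex.exp z := by
    ext i
    rw [Pi.coe_exp]
    simp [Complex.exp_eq_exp_ℂ]
  rw [this, ← Matrix.smul_one_eq_diagonal]
  simp

lemma exists_decomp (hN : 0 < N) (W : UG N) : ∃ (φ : ℝ) (A1 A2 : Mat N), |φ| ≤ Real.pi / N ∧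
    A1ᴴ = -A1 ∧ A2ᴴ = -A2 ∧ Matrix.trace A1 = 0 ∧ Matrix.trace A2 = 0 ∧
    ‖A1‖ ≤ 2 * Real.pi * N ^ 2 ∧ ‖A2‖ ≤ 2 * Real.pi * N ^ 2 ∧
    (W : Mat N) = Complex.exp (Complex.I * φ) • ((eU A1 * eU A2 : UG N) : Mat N) := by
  obtain ⟨H, hH, hHe, hHx⟩ := exists_log_mat W
  have hN1 : (1 : ℝ) ≤ N := by exact_mod_cast hN
  have hNc : (N : ℂ) ≠ 0 := by exact_mod_cast hN.ne'
  have hpi := Real.pi_pos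
  set τ : ℝ := (Matrix.trace H).re with hτ
  have hτc : Matrix.trace H = (τ : ℂ) := by
    have : star (Matrix.trace H) = Matrix.trace H := by
      rw [← Matrix.trace_conjTranspose, hH]
    exact (Complex.conj_eq_iff_re.1 this).symm
  set k : ℤ := round (τ / (2 * Real.pi)) with hk
  have hkr := abs_sub_round (τ / (2 * Real.pi))
  rw [← hk] at hkr
  have hφ : |τ - 2 * Real.pi * k| ≤ Real.pi := by
    have : τ - 2 * Real.pi * k = 2 * Real.pi * (τ / (2 * Real.pi) - k) := by field_simp
    rw [this, abs_mul, abs_of_pos (by positivity)]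
    nlinarith
  have hτb : |τ| ≤ N * Real.pi := by
    rw [hτ]
    refine (Complex.abs_re_le_norm _).trans ?_
    refine (norm_sum_le _ _).trans ?_
    refine (Finset.sum_le_sum fun i _ => hHe i i).trans ?_
    simp
  have hkb : |(k : ℝ)| ≤ N := by
    have h1 : |2 * Real.pi * (k : ℝ)| ≤ 2 * Real.pi * N := by
      rw [abs_le] at hφ hτb ⊢
      constructor <;> nlinarith
    rw [abs_mul, abs_of_pos (by positivity)] at h1
    exact le_of_mul_le_mul_left h1 (by positivity)
  set i0 : Fin N := ⟨0, hN⟩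
  set v : Fin N → ℂ := fun i => Complex.I * ((-(2 * Real.pi * k) * ((if i = i0 then 1 else 0) - 1 / N) : ℝ) : ℂ)
    with hv
  have hHn : ‖H‖ ≤ N * Real.pi := norm_le_of_entries H _ hpi.le hHe
  have s1 : (Complex.I • trProj H)ᴴ = -(Complex.I • trProj H) := by
    rw [Matrix.conjTranspose_smul, trProj, Matrix.conjTranspose_sub, Matrix.conjTranspose_smul, hH, hτc]
    simp
  have s2 : (Matrix.diagonal v)ᴴ = - Matrix.diagonal v := by
    rw [Matrix.diagonal_conjTranspose, Matrix.diagonal_neg]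
    congr 1; ext i
    simp only [hv, Pi.star_apply, Pi.neg_apply, star_mul', Complex.star_def, Complex.conj_I,
      Complex.conj_ofReal, neg_mul]
  refine ⟨(τ - 2 * Real.pi * k) / N, Complex.I • trProj H, Matrix.diagonal v, ?_, s1, s2, ?_, ?_,
    ?_, ?_, ?_⟩
  · rw [abs_div, abs_of_pos (by positivity : (0 : ℝ) < N)]
    exact div_le_div_of_nonneg_right hφ (by positivity)
  · rw [Matrix.trace_smul, trProj_trace hN, smul_zero]
  · rw [Matrix.trace_diagonal]
    simp only [hv]
    rw [← Finset.mul_sum, ← Complex.ofReal_sum, ← Finset.mul_sum, Finset.sum_sub_distrib]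
    simp [hNc]
  · rw [norm_smul, Complex.norm_I, one_mul]
    refine (norm_trProj_le H).trans (hHn.trans ?_)
    have h5 : (N : ℝ) ≤ 2 * N ^ 2 := by nlinarith
    have h6 := mul_le_mul_of_nonneg_right h5 hpi.le
    linarith
  · refine (norm_le_of_entries _ (2 * Real.pi * N) (by positivity) ?_).trans (by nlinarith)
    intro i j
    rw [Matrix.diagonal_apply]
    split_ifs with hij
    · simp only [hv]
      rw [norm_mul, Complex.norm_I, one_mul, Complex.norm_real, Real.norm_eq_abs, abs_mul, abs_neg,
        abs_mul, abs_of_pos (by positivity : 0 < 2 * Real.pi)]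
      have h1 : |(if i = i0 then (1 : ℝ) else 0) - 1 / N| ≤ 1 := by
        have h0 : (0 : ℝ) ≤ 1 / N := by positivity
        have h2 : (1 : ℝ) / N ≤ 1 := by rw [div_le_one (by positivity)]; exact hN1
        rw [abs_le]
        split_ifs <;> constructor <;> linarith
      calc 2 * Real.pi * |(k : ℝ)| * _ ≤ 2 * Real.pi * |(k : ℝ)| * 1 :=
            mul_le_mul_of_nonneg_left h1 (by positivity)
        _ ≤ _ := by rw [mul_one]; exact mul_le_mul_of_nonneg_left hkb (by positivity)
    · simp; positivity
  · rw [Submonoid.coe_mul, coe_eU s1, coe_eU s2, ← hHx]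
    have e1 : Complex.I • H = Complex.I • trProj H
        + Matrix.diagonal (fun _ => Complex.I * (τ / N)) := by
      rw [trProj, hτc, smul_sub, smul_smul, ← Matrix.smul_one_eq_diagonal]; simp
    have e2 : NormedSpace.exp (Matrix.diagonal v)
        = Complex.exp (Complex.I * (2 * Real.pi * k / N)) • (1 : Mat N) := by
      rw [Matrix.exp_diagonal, Matrix.smul_one_eq_diagonal]
      congr 1; ext i
      rw [Pi.coe_exp, ← Complex.exp_eq_exp_ℂ]
      simp only [hv]
      split_ifs
      · rw [Complex.exp_eq_exp_iff_exists_int]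
        refine ⟨-k, ?_⟩
        push_cast; field_simp; ring
      · congr 1
        push_cast; field_simp; ring
    rw [e1, exp_dconst, e2, Matrix.mul_smul, mul_one, smul_smul, ← Complex.exp_add]
    congr 2
    push_cast; field_simp; ring

lemma osc_le (hN : 0 < N) {L K : ℝ} {g : UG N → ℝ} (h : FL L g) (hK : GeoL K g) (hL0 : 0 ≤ L)
    (hK0 : 0 ≤ K) (U V : UG N) :
    |g U - g V| ≤ L * (Real.pi / Real.sqrt N) + K * (4 * Real.pi * N ^ 2) := by
  obtain ⟨φ, A1, A2, hφ, s1, s2, t1, t2, n1, n2, hW⟩ := exists_decomp hN (V⁻¹ * U)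
  have hN0 : (0 : ℝ) < N := by exact_mod_cast hN
  have b1 := hK V A1 s1 t1
  have b2 := hK (V * eU A1) A2 s2 t2
  have b3 : |g U - g (V * eU A1 * eU A2)| ≤ L * (Real.pi / Real.sqrt N) := by
    refine (h _ _).trans (mul_le_mul_of_nonneg_left ?_ hL0)
    have e1 : (U : Mat N) - ((V * eU A1 * eU A2 : UG N) : Mat N)
        = (V : Mat N) * ((Complex.exp (Complex.I * φ) - 1) • ((eU A1 * eU A2 : UG N) : Mat N)) := by
      have hU : (U : Mat N) = (V : Mat N) * ((V⁻¹ * U : UG N) : Mat N) := by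
        rw [← Submonoid.coe_mul]; simp
      rw [hU, hW, sub_smul, one_smul, mul_sub, mul_assoc V]
      rfl
    rw [e1, norm_unitary_mul, norm_smul, norm_UG]
    have hn : ‖(1 : Mat N)‖ = Real.sqrt N := by
      rw [← norm_one_sq, Real.sqrt_sq (norm_nonneg _)]
    rw [hn]
    have := Real.norm_exp_I_mul_ofReal_sub_one_le (x := φ)
    rw [Real.norm_eq_abs] at this
    refine (mul_le_mul_of_nonneg_right (this.trans hφ) (Real.sqrt_nonneg _)).trans (le_of_eq ?_)
    have hs : Real.sqrt N * Real.sqrt N = N := Real.mul_self_sqrt hN0.le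
    have : Real.sqrt N ≠ 0 := by positivity
    field_simp
    rw [sq, hs]
  have c1 := mul_le_mul_of_nonneg_left n1 hK0
  have c2 := mul_le_mul_of_nonneg_left n2 hK0
  have := abs_sub_le (g U) (g (V * eU A1 * eU A2)) (g V)
  have := abs_sub_le (g (V * eU A1 * eU A2)) (g (V * eU A1)) (g V)
  linarith

end Osc

set_option linter.unusedSectionVars false
section Iter
open scoped Matrix Matrix.Norms.Frobenius
variable {N : ℕ}
variable [MeasurableSpace (UG N)] [BorelSpace (UG N)] (μ : Measure (UG N)) [IsProbabilityMeasure μ]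

lemma Pop_neg (e : ℝ) (g : UG N → ℝ) : Pop μ e (fun V => - g V) = fun V => - Pop μ e g V := by
  ext U
  unfold Pop av
  rw [← integral_neg]
  simp

lemma iter_neg (e : ℝ) (g : UG N → ℝ) (n : ℕ) :
    (Pop μ e)^[n] (fun V => - g V) = fun V => - (Pop μ e)^[n] g V := by
  induction n with
  | zero => rfl
  | succ n ih => rw [Function.iterate_succ_apply', ih, Pop_neg, Function.iterate_succ_apply']

lemma iter_props (hN : 0 < N) (hH : ∀ g : UG N, MeasurePreserving (fun x => g * x) μ μ)
    {L C : ℝ} {f : UG N → ℝ} (hL0 : 0 ≤ L) (h : FL L f) (hD : Diff1 C f)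
    (e : ℝ) (he0 : 0 ≤ e) (he1 : e ≤ 1 / (16 * N)) (n : ℕ) :
    FL L ((Pop μ e)^[n] f) ∧ Diff1 C ((Pop μ e)^[n] f) ∧
      GeoL (L * Real.sqrt (1 - e ^ 2 / (8 * N)) ^ n) ((Pop μ e)^[n] f) := by
  induction n with
  | zero => exact ⟨h, hD, by simpa using GeoL_of_FL hL0 h⟩
  | succ n ih =>
    obtain ⟨h1, h2, h3⟩ := ih
    rw [Function.iterate_succ_apply']
    refine ⟨FL_Pop μ hN h1 e, Diff1_Pop μ hN h1.continuous h2 e, ?_⟩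
    have := GeoL_Pop μ hN hH h1 h3 (by positivity) hL0 e he0 he1
    rwa [mul_assoc, ← pow_succ] at this

lemma q_bounds (hN : 0 < N) (e : ℝ) (he0 : 0 ≤ e) (he1 : e ≤ 1 / (16 * N)) :
    0 ≤ 1 - e ^ 2 / (8 * (N : ℝ)) ∧ 1 - e ^ 2 / (8 * (N : ℝ)) ≤ 1 ∧ e ≤ 1 := by
  have hN' : (1 : ℝ) ≤ N := by exact_mod_cast hN
  have h1 : e ≤ 1 := he1.trans (by rw [div_le_one (by positivity)]; linarith)
  refine ⟨?_, ?_, h1⟩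
  · rw [sub_nonneg, div_le_one (by positivity)]
    nlinarith
  · have : 0 ≤ e ^ 2 / (8 * (N : ℝ)) := by positivity
    linarith

lemma iter_mgf (hN : 0 < N) (hH : ∀ g : UG N, MeasurePreserving (fun x => g * x) μ μ)
    {L C : ℝ} {f : UG N → ℝ} (hL0 : 0 ≤ L) (hC : 0 ≤ C) (h : FL L f) (hD : Diff1 C f)
    (e : ℝ) (he0 : 0 ≤ e) (he1 : e ≤ 1 / (16 * N)) (heL : L * e ≤ 1) (n : ℕ) :
    ∫ U, Real.exp (f U) ∂μ ≤
      Real.exp (∑ k ∈ Finset.range n, (e ^ 2 * (L ^ 2 * (1 - e ^ 2 / (8 * N)) ^ k) / (4 * (N : ℝ) ^ 2)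
        + (L * C + C ^ 2 + L ^ 3) * e ^ 3)) * ∫ U, Real.exp ((Pop μ e)^[n] f U) ∂μ := by
  obtain ⟨hq0, hq1, he1'⟩ := q_bounds hN e he0 he1
  induction n with
  | zero => simp
  | succ n ih =>
    obtain ⟨h1, h2, h3⟩ := iter_props μ hN hH hL0 h hD e he0 he1 n
    rw [Finset.sum_range_succ, Real.exp_add, mul_assoc]
    refine ih.trans (mul_le_mul_of_nonneg_left ?_ (Real.exp_pos _).le)
    set g := (Pop μ e)^[n] f with hg
    rw [Function.iterate_succ_apply', ← hg]
    have hip := int_Pop μ hN hH (g := fun V => Real.exp (g V))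
      (Real.continuous_exp.comp h1.continuous) e
    rw [← hip, ← integral_const_mul]
    have hgP := (FL_Pop μ hN h1 e).continuous
    have hs1 : Real.sqrt (1 - e ^ 2 / (8 * N)) ≤ 1 := by
      rw [Real.sqrt_le_left zero_le_one, one_pow]; exact hq1
    have hKL : L * Real.sqrt (1 - e ^ 2 / (8 * N)) ^ n ≤ L :=
      mul_le_of_le_one_right hL0 (pow_le_one₀ (Real.sqrt_nonneg _) hs1)
    have hK2 : (L * Real.sqrt (1 - e ^ 2 / (8 * N)) ^ n) ^ 2 = L ^ 2 * (1 - e ^ 2 / (8 * N)) ^ n := by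
      rw [mul_pow, ← pow_mul, mul_comm n 2, pow_mul, Real.sq_sqrt hq0]
    have key : ∀ U, Pop μ e (fun V => Real.exp (g V)) U ≤ 
        Real.exp (e ^ 2 * (L ^ 2 * (1 - e ^ 2 / (8 * N)) ^ n) / (4 * (N : ℝ) ^ 2)
        + (L * C + C ^ 2 + L ^ 3) * e ^ 3) * Real.exp (Pop μ e g U) := by
      intro U
      have := Pop_exp_le μ hN h1 h3 (by positivity) hKL hC h2 e he0 he1' heL U
      rw [hK2] at this
      rwa [← Real.exp_add, add_comm (_ + _) (Pop μ e g U)]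
    refine integral_mono_of_nonneg (Filter.Eventually.of_forall fun U => ?_)
      (cont_int μ (continuous_const.mul (Real.continuous_exp.comp hgP)))
      (Filter.Eventually.of_forall key)
    refine integral_nonneg fun W => ?_
    exact mul_nonneg (by positivity) (Finset.sum_nonneg fun a _ => (Real.exp_pos _).le)

lemma sum_bound (hN : 0 < N) (L D e : ℝ) (he0 : 0 < e) (he1 : e ≤ 1 / (16 * N)) (n : ℕ) :
    ∑ k ∈ Finset.range n, (e ^ 2 * (L ^ 2 * (1 - e ^ 2 / (8 * N)) ^ k) / (4 * (N : ℝ) ^ 2)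
        + D * e ^ 3) ≤ 2 * L ^ 2 / N + n * (D * e ^ 3) := by
  obtain ⟨hq0, hq1, he1'⟩ := q_bounds hN e he0.le he1
  have hN0 : (0 : ℝ) < N := by exact_mod_cast hN
  set q := 1 - e ^ 2 / (8 * (N : ℝ)) with hq
  rw [Finset.sum_add_distrib]
  have h1 : ∑ k ∈ Finset.range n, e ^ 2 * (L ^ 2 * q ^ k) / (4 * (N : ℝ) ^ 2)
      = (e ^ 2 * L ^ 2 / (4 * (N : ℝ) ^ 2)) * ∑ k ∈ Finset.range n, q ^ k := by
    rw [Finset.mul_sum]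
    refine Finset.sum_congr rfl fun k _ => ?_
    ring
  have h2 : ∑ k ∈ Finset.range n, q ^ k ≤ 8 * N / e ^ 2 := by
    have h3 := mul_neg_geom_sum q n
    have h4 : 1 - q = e ^ 2 / (8 * N) := by rw [hq]; ring
    rw [h4] at h3
    have h5 : 0 ≤ q ^ n := pow_nonneg hq0 n
    have h6 : e ^ 2 / (8 * N) * ∑ k ∈ Finset.range n, q ^ k ≤ 1 := by linarith
    rw [le_div_iff₀ (by positivity)]
    rw [div_mul_eq_mul_div, div_le_one (by positivity)] at h6
    linarith
  have h3 := mul_le_mul_of_nonneg_left h2 (by positivity : 0 ≤ e ^ 2 * L ^ 2 / (4 * (N : ℝ) ^ 2))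
  have h4 : e ^ 2 * L ^ 2 / (4 * (N : ℝ) ^ 2) * (8 * N / e ^ 2) = 2 * L ^ 2 / N := by
    field_simp; ring
  rw [h1]
  simp only [Finset.sum_const, Finset.card_range, nsmul_eq_mul]
  linarith

lemma osc_mgf {g : UG N → ℝ} (hg : Continuous g) (D : ℝ) (hD : ∀ U V, |g U - g V| ≤ D) :
    (∫ U, Real.exp (g U) ∂μ) * (∫ U, Real.exp (- g U) ∂μ) ≤ Real.exp (D ^ 2 / 2) := by
  have hc1 : Continuous fun U => Real.exp (g U) := Real.continuous_exp.comp hg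
  have hc2 : Continuous fun U => Real.exp (- g U) := Real.continuous_exp.comp hg.neg
  have e1 := integral_prod_mul (μ := μ) (ν := μ) (fun U => Real.exp (g U)) (fun U => Real.exp (- g U))
  have e2 := integral_prod_mul (μ := μ) (ν := μ) (fun U => Real.exp (- g U)) (fun U => Real.exp (g U))
  have i1 := (cont_int μ hc1).mul_prod (cont_int μ hc2)
  have i2 := (cont_int μ hc2).mul_prod (cont_int μ hc1)
  have key : ∫ p : UG N × UG N, (Real.exp (g p.1) * Real.exp (- g p.2) +
      Real.exp (- g p.1) * Real.exp (g p.2)) ∂(μ.prod μ) ≤ ∫ _p : UG N × UG N, 2 * Real.exp (D ^ 2 / 2) ∂(μ.prod μ) := by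
    refine integral_mono (i1.add i2) (integrable_const _) fun p => ?_
    simp only
    have h1 := Real.cosh_le_exp_half_sq (g p.1 - g p.2)
    rw [Real.cosh_eq] at h1
    have h2 : Real.exp ((g p.1 - g p.2) ^ 2 / 2) ≤ Real.exp (D ^ 2 / 2) := by
      apply Real.exp_le_exp.2
      have := pow_le_pow_left₀ (abs_nonneg _) (hD p.1 p.2) 2
      rw [sq_abs] at this
      linarith
    rw [← Real.exp_add, ← Real.exp_add]
    have h3 : -(g p.1 - g p.2) = - g p.1 + g p.2 := by ring
    rw [h3, sub_eq_add_neg] at h1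
    rw [sub_eq_add_neg] at h2
    linarith
  rw [integral_add i1 i2, e1, e2] at key
  simp only [integral_const, probReal_univ, one_smul] at key
  nlinarith

lemma mgf_pre (hN : 0 < N) (hH : ∀ g : UG N, MeasurePreserving (fun x => g * x) μ μ)
    {L C : ℝ} {f : UG N → ℝ} (hL0 : 0 ≤ L) (hC : 0 ≤ C) (h : FL L f) (hD : Diff1 C f)
    (e : ℝ) (he0 : 0 < e) (he1 : e ≤ 1 / (16 * N)) (heL : L * e ≤ 1) (n : ℕ) :
    (∫ U, Real.exp (f U) ∂μ) * (∫ U, Real.exp (- f U) ∂μ) ≤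
      Real.exp (4 * L ^ 2 / N + 2 * (L * C + C ^ 2 + L ^ 3) * (n * e ^ 3) +
        (L * (Real.pi / Real.sqrt N) + L * Real.exp (-(n * e ^ 2) / (16 * N)) * (4 * Real.pi * N ^ 2)) ^ 2 / 2) := by
  obtain ⟨hq0, hq1, he1'⟩ := q_bounds hN e he0.le he1
  have hN0 : (0 : ℝ) < N := by exact_mod_cast hN
  have h' : FL L (fun V => - f V) := by
    intro U V
    have := h U V
    rw [← abs_neg] at this
    convert this using 2; ring
  have hD' : Diff1 C (fun V => - f V) := by
    obtain ⟨l, hlc, hl⟩ := hD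
    refine ⟨fun U => - l U, hlc.neg, fun U X hX hX1 => ?_⟩
    have := hl U X hX hX1
    rw [← abs_neg] at this
    convert this using 2
    simp only [LinearMap.neg_apply]; ring
  have m1 := iter_mgf μ hN hH hL0 hC h hD e he0.le he1 heL n
  have m2 := iter_mgf μ hN hH hL0 hC h' hD' e he0.le he1 heL n
  rw [iter_neg] at m2
  have sb := sum_bound hN L (L * C + C ^ 2 + L ^ 3) e he0 he1 n
  set S := ∑ k ∈ Finset.range n, (e ^ 2 * (L ^ 2 * (1 - e ^ 2 / (8 * N)) ^ k) / (4 * (N : ℝ) ^ 2)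
        + (L * C + C ^ 2 + L ^ 3) * e ^ 3) with hS
  obtain ⟨h1, h2, h3⟩ := iter_props μ hN hH hL0 h hD e he0.le he1 n
  set g := (Pop μ e)^[n] f with hg
  have hs : Real.sqrt (1 - e ^ 2 / (8 * N)) ^ n ≤ Real.exp (-(n * e ^ 2) / (16 * N)) := by
    have a1 : Real.sqrt (1 - e ^ 2 / (8 * N)) ≤ Real.exp (-(e ^ 2) / (16 * N)) := by
      rw [Real.sqrt_le_left (Real.exp_pos _).le, ← Real.exp_nat_mul]
      have := Real.add_one_le_exp (-(e ^ 2 / (8 * (N : ℝ))))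
      refine le_trans (by linarith) (this.trans (le_of_eq ?_))
      congr 1; push_cast; field_simp; norm_num
    refine (pow_le_pow_left₀ (Real.sqrt_nonneg _) a1 n).trans (le_of_eq ?_)
    rw [← Real.exp_nat_mul]
    congr 1; ring
  have ho := osc_mgf μ h1.continuous
    (L * (Real.pi / Real.sqrt N) + L * Real.exp (-(n * e ^ 2) / (16 * N)) * (4 * Real.pi * N ^ 2))
    (fun U V => (osc_le hN h1 h3 hL0 (by positivity) U V).trans (by gcongr))
  have p1 : 0 ≤ ∫ U, Real.exp (- f U) ∂μ := integral_nonneg fun U => (Real.exp_pos _).le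
  have p2 : 0 ≤ ∫ U, Real.exp (g U) ∂μ := integral_nonneg fun U => (Real.exp_pos _).le
  refine (mul_le_mul m1 m2 p1 (mul_nonneg (Real.exp_pos _).le p2)).trans ?_
  have e1 : Real.exp S * (∫ U, Real.exp (g U) ∂μ) * (Real.exp S * ∫ U, Real.exp (- g U) ∂μ)
      = Real.exp (S + S) * ((∫ U, Real.exp (g U) ∂μ) * ∫ U, Real.exp (- g U) ∂μ) := by
    rw [Real.exp_add]; ring
  rw [e1, Real.exp_add (_ + _)]
  refine mul_le_mul (Real.exp_le_exp.2 ?_) ho (mul_nonneg p2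
    (integral_nonneg fun U => (Real.exp_pos _).le)) (Real.exp_pos _).le
  have : 4 * L ^ 2 / (N : ℝ) = 2 * (2 * L ^ 2 / N) := by ring
  rw [this]
  linarith

lemma mgf_smooth (hN : 0 < N) (hH : ∀ g : UG N, MeasurePreserving (fun x => g * x) μ μ)
    {L C : ℝ} {f : UG N → ℝ} (hL0 : 0 ≤ L) (hC : 0 ≤ C) (h : FL L f) (hD : Diff1 C f) :
    (∫ U, Real.exp (f U) ∂μ) * (∫ U, Real.exp (- f U) ∂μ) ≤ Real.exp (9 * L ^ 2 / N) := by
  have hN0 : (0 : ℝ) < N := by exact_mod_cast hN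
  have lim1 : Filter.Tendsto (fun j : ℕ => 1 / (j : ℝ)) Filter.atTop (nhds 0) :=
    tendsto_one_div_atTop_nhds_zero_nat
  have lim2 : Filter.Tendsto (fun j : ℕ => (1 / (j : ℝ)) ^ 2) Filter.atTop (nhds 0) := by
    simpa using lim1.pow 2
  have lim3 : Filter.Tendsto (fun j : ℕ => Real.exp (-(j : ℝ) / (16 * N))) Filter.atTop (nhds 0) := by
    apply Real.tendsto_exp_atBot.comp
    have : Filter.Tendsto (fun j : ℕ => (j : ℝ) / (16 * N)) Filter.atTop Filter.atTop :=
      tendsto_natCast_atTop_atTop.atTop_div_const (by positivity)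
    have h2 := Filter.tendsto_neg_atTop_atBot.comp this
    refine h2.congr fun j => ?_
    simp [neg_div]
  have lim4 : Filter.Tendsto (fun j : ℕ => Real.exp (4 * L ^ 2 / N +
      2 * (L * C + C ^ 2 + L ^ 3) * (1 / (j : ℝ)) +
        (L * (Real.pi / Real.sqrt N) + L * Real.exp (-(j : ℝ) / (16 * N)) * (4 * Real.pi * N ^ 2)) ^ 2 / 2))
      Filter.atTop (nhds (Real.exp (4 * L ^ 2 / N +
      2 * (L * C + C ^ 2 + L ^ 3) * 0 +
        (L * (Real.pi / Real.sqrt N) + L * 0 * (4 * Real.pi * N ^ 2)) ^ 2 / 2))) := by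
    refine (Real.continuous_exp.tendsto _).comp ?_
    refine ((lim1.const_mul _).const_add _).add (Filter.Tendsto.div_const (Filter.Tendsto.pow ?_ 2) 2)
    exact ((lim3.const_mul L).mul_const _).const_add _
  have ev1 : ∀ᶠ j : ℕ in Filter.atTop, (1 / (j : ℝ)) ^ 2 < 1 / (16 * N) :=
    lim2.eventually_lt_const (by positivity)
  have ev2 : ∀ᶠ j : ℕ in Filter.atTop, L * (1 / (j : ℝ)) ^ 2 < 1 := by
    have := lim2.const_mul L
    rw [mul_zero] at this
    exact this.eventually_lt_const one_pos
  refine (ge_of_tendsto lim4 (b := (∫ U, Real.exp (f U) ∂μ) * (∫ U, Real.exp (- f U) ∂μ)) ?_).trans ?_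
  · filter_upwards [ev1, ev2, Filter.eventually_gt_atTop 0] with j h1 h2 h3
    have hj : (0 : ℝ) < j := by exact_mod_cast h3
    have := mgf_pre μ hN hH hL0 hC h hD ((1 / (j : ℝ)) ^ 2) (by positivity) h1.le h2.le (j ^ 5)
    have a1 : ((j ^ 5 : ℕ) : ℝ) * ((1 / (j : ℝ)) ^ 2) ^ 3 = 1 / j := by
      push_cast; field_simp
    have a2 : ((j ^ 5 : ℕ) : ℝ) * ((1 / (j : ℝ)) ^ 2) ^ 2 = j := by
      push_cast; field_simp
    rwa [a1, a2] at this
  · apply Real.exp_le_exp.2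
    have hs : Real.sqrt N ^ 2 = N := Real.sq_sqrt hN0.le
    have e1 : 4 * L ^ 2 / (N : ℝ) + 2 * (L * C + C ^ 2 + L ^ 3) * 0 +
        (L * (Real.pi / Real.sqrt N) + L * 0 * (4 * Real.pi * N ^ 2)) ^ 2 / 2
        = (4 + Real.pi ^ 2 / 2) * L ^ 2 / N := by
      have : (L * (Real.pi / Real.sqrt N) + L * 0 * (4 * Real.pi * N ^ 2)) ^ 2 
        = L ^ 2 * Real.pi ^ 2 / N := by
        rw [mul_zero, zero_mul, add_zero, mul_pow, div_pow, hs]; ring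
      rw [this]; ring
    rw [e1]
    have hpi := Real.pi_lt_d2
    have hp0 := Real.pi_pos
    have : 4 + Real.pi ^ 2 / 2 ≤ 9 := by nlinarith
    gcongr

end Iter

section Smooth

open Convolution in
lemma exists_smooth_approx {E : Type*} [NormedAddCommGroup E] [NormedSpace ℝ E]
    [FiniteDimensional ℝ E] {K : NNReal} {F : E → ℝ} (hF : LipschitzWith K F) {δ : ℝ} (hδ : 0 < δ) :
    ∃ G : E → ℝ, ContDiff ℝ 2 G ∧ LipschitzWith K G ∧ ∀ x, |G x - F x| ≤ δ := by
  let _ : MeasurableSpace E := borel E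
  have : BorelSpace E := ⟨rfl⟩
  set ν : Measure E := Measure.addHaar
  set r : ℝ := δ / (K + 1) with hr
  have hr0 : 0 < r := by positivity
  set φ : ContDiffBump (0 : E) := ⟨r / 2, r, by positivity, by linarith⟩ with hφ
  have hc : Continuous (φ.normed ν) := φ.continuous_normed
  have hcs : HasCompactSupport (φ.normed ν) := φ.hasCompactSupport_normed
  have hint : ∀ x, Integrable (fun t => φ.normed ν t * F (x - t)) ν := fun x =>
    (hc.mul (hF.continuous.comp (continuous_const.sub continuous_id))).integrable_of_hasCompactSupport
      hcs.mul_right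
  have hG : ∀ x, (φ.normed ν ⋆[ContinuousLinearMap.lsmul ℝ ℝ, ν] F) x
      = ∫ t, φ.normed ν t * F (x - t) ∂ν := fun x => rfl
  refine ⟨φ.normed ν ⋆[ContinuousLinearMap.lsmul ℝ ℝ, ν] F, ?_, ?_, ?_⟩
  · exact hcs.contDiff_convolution_left _ φ.contDiff_normed hF.continuous.locallyIntegrable
  · apply LipschitzWith.of_dist_le_mul
    intro x y
    rw [Real.dist_eq, hG, hG, ← integral_sub (hint x) (hint y)]
    have hb : ∀ t, ‖φ.normed ν t * F (x - t) - φ.normed ν t * F (y - t)‖ ≤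
        φ.normed ν t * (K * dist x y) := by
      intro t
      rw [← mul_sub, norm_mul, Real.norm_of_nonneg (φ.nonneg_normed t)]
      refine mul_le_mul_of_nonneg_left ?_ (φ.nonneg_normed t)
      have := hF.dist_le_mul (x - t) (y - t)
      rwa [dist_sub_right, Real.dist_eq] at this
    have h1 := norm_integral_le_of_norm_le (φ.integrable_normed.mul_const (K * dist x y))
      (Filter.Eventually.of_forall hb)
    rwa [integral_mul_const, φ.integral_normed, one_mul] at h1
  · intro x
    have := φ.dist_normed_convolution_le (μ := ν) (g := F) (x₀ := x) (ε := δ)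
      hF.continuous.aestronglyMeasurable (fun y hy => by
        refine (hF.dist_le_mul y x).trans ?_
        have h1 : dist y x ≤ r := (Metric.mem_ball.1 hy).le
        refine (mul_le_mul_of_nonneg_left h1 K.coe_nonneg).trans ?_
        rw [hr, ← mul_div_assoc, div_le_iff₀ (by positivity)]
        nlinarith [K.coe_nonneg, hδ])
    rwa [Real.dist_eq] at this

lemma taylor_ball {E : Type*} [NormedAddCommGroup E] [NormedSpace ℝ E]
    [FiniteDimensional ℝ E] {G : E → ℝ} (hG : ContDiff ℝ 2 G) (R : ℝ) :
    ∃ M : ℝ, 0 ≤ M ∧ ∀ x y : E, ‖x‖ ≤ R → ‖y‖ ≤ R →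
      |G y - G x - fderiv ℝ G x (y - x)| ≤ M * ‖y - x‖ ^ 2 := by
  have hd : ContDiff ℝ 1 (fderiv ℝ G) := hG.fderiv_right (by norm_num)
  have hdd : Continuous (fderiv ℝ (fderiv ℝ G)) := hd.continuous_fderiv (by norm_num)
  have hK : IsCompact (Metric.closedBall (0 : E) R) := isCompact_closedBall 0 R
  obtain ⟨M, hM⟩ := hK.exists_bound_of_continuousOn (E := E →L[ℝ] E →L[ℝ] ℝ)
    (f := fderiv ℝ (fderiv ℝ G)) hdd.continuousOn
  refine ⟨max M 0, le_max_right _ _, fun x y hx hy => ?_⟩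
  have hlip : ∀ z ∈ Metric.closedBall (0 : E) R, ‖fderiv ℝ G z - fderiv ℝ G x‖ ≤ max M 0 * ‖z - x‖ := by
    intro z hz
    refine (convex_closedBall (0 : E) R).norm_image_sub_le_of_norm_fderiv_le (𝕜 := ℝ)
      (fun w _ => (hd.differentiable (by norm_num)) w) (fun w hw => ?_) (by simpa using hx) hz
    exact (hM w hw).trans (le_max_left _ _)
  have hconv : Convex ℝ (Metric.closedBall (0 : E) R ∩ Metric.closedBall x ‖y - x‖) :=
    (convex_closedBall _ _).inter (convex_closedBall _ _)
  have := hconv.norm_image_sub_le_of_norm_fderiv_le' (𝕜 := ℝ) (f := G) (φ := fderiv ℝ G x)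
    (C := max M 0 * ‖y - x‖) (x := x) (y := y)
    (fun w _ => (hG.differentiable (by norm_num)) w) (fun w hw => ?_)
    ⟨by simpa using hx, by simp⟩ ⟨by simpa using hy, by simp [dist_eq_norm]⟩
  · rw [Real.norm_eq_abs] at this
    refine this.trans (le_of_eq (by ring))
  · refine (hlip w hw.1).trans (mul_le_mul_of_nonneg_left ?_ (le_max_right _ _))
    have := hw.2
    rwa [Metric.mem_closedBall, dist_eq_norm] at this

open scoped Matrix Matrix.Norms.Frobenius
variable {N : ℕ}

lemma abs_aux {a b c d M K x : ℝ} (h2 : |a - b - (c + d)| ≤ M * (4 * x)) (n2 : |d| ≤ K * x) :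
    |a - b - c| ≤ (4 * M + K) * x := by
  rw [abs_le] at h2 n2 ⊢
  constructor <;> linarith [h2.1, h2.2, n2.1, n2.2]

lemma Diff1_of_contDiff {K : NNReal} {G : Mat N → ℝ} (hG : ContDiff ℝ 2 G) (hL : LipschitzWith K G) :
    ∃ C : ℝ, 0 ≤ C ∧ Diff1 C (fun U : UG N => G (U : Mat N)) := by
  obtain ⟨M, hM0, hM⟩ := taylor_ball hG ‖(1 : Mat N)‖
  refine ⟨4 * M + K, by positivity, fun U => (fderiv ℝ G (U : Mat N)).toLinearMap ∘ₗ
    LinearMap.mulLeft ℝ (U : Mat N), ?_, ?_⟩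
  · have h1 : Continuous fun p : UG N × Mat N => fderiv ℝ G (p.1 : Mat N) :=
      (hG.continuous_fderiv (by norm_num)).comp (continuous_subtype_val.comp continuous_fst)
    have h2 : Continuous fun p : UG N × Mat N => (p.1 : Mat N) * p.2 :=
      (continuous_subtype_val.comp continuous_fst).mul continuous_snd
    exact h1.clm_apply h2
  · intro U X hX hX1
    have h1 := hM (U : Mat N) ((U * eU X : UG N) : Mat N) (norm_UG U).le (norm_UG _).le
    set r := NormedSpace.exp X - 1 - X with hr
    have hrn : ‖r‖ ≤ ‖X‖ ^ 2 := norm_exp_sub X hX1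
    have e1 : ((U * eU X : UG N) : Mat N) - (U : Mat N) = (U : Mat N) * X + (U : Mat N) * r := by
      rw [Submonoid.coe_mul, coe_eU hX, hr]; noncomm_ring
    have n1 : ‖((U * eU X : UG N) : Mat N) - (U : Mat N)‖ ≤ 2 * ‖X‖ := by
      rw [e1]
      refine (norm_add_le _ _).trans ?_
      rw [norm_unitary_mul, norm_unitary_mul]
      nlinarith [norm_nonneg X]
    have n2 : |fderiv ℝ G (U : Mat N) ((U : Mat N) * r)| ≤ K * ‖X‖ ^ 2 := by
      have := (fderiv ℝ G (U : Mat N)).le_of_opNorm_le (norm_fderiv_le_of_lipschitz ℝ hL)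
        ((U : Mat N) * r)
      rw [norm_unitary_mul] at this
      exact this.trans (mul_le_mul_of_nonneg_left hrn K.coe_nonneg)
    have n3 : M * ‖((U * eU X : UG N) : Mat N) - (U : Mat N)‖ ^ 2 ≤ M * (4 * ‖X‖ ^ 2) := by
      refine mul_le_mul_of_nonneg_left ?_ hM0
      refine (pow_le_pow_left₀ (norm_nonneg _) n1 2).trans (le_of_eq (by ring))
    have h2 := h1.trans n3
    rw [e1, map_add] at h2
    simp only [LinearMap.comp_apply, LinearMap.mulLeft_apply, ContinuousLinearMap.coe_coe]
    exact abs_aux h2 n2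

lemma exists_smooth_UG {L : ℝ} (hL : 0 ≤ L) {f : UG N → ℝ} (hf : FL L f) {δ : ℝ} (hδ : 0 < δ) :
    ∃ (g : UG N → ℝ) (C : ℝ), 0 ≤ C ∧ FL L g ∧ Diff1 C g ∧ ∀ U, |g U - f U| ≤ δ := by
  classical
  set K : NNReal := ⟨L, hL⟩ with hK
  set f0 : Mat N → ℝ := fun M => if h : M ∈ Matrix.unitaryGroup (Fin N) ℂ then f ⟨M, h⟩ else 0 with hf0
  have h0 : ∀ U : UG N, f0 (U : Mat N) = f U := fun U => by
    rw [hf0]; simp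
  have hlo : LipschitzOnWith K f0 (Set.range ((↑) : UG N → Mat N)) := by
    apply LipschitzOnWith.of_dist_le_mul
    rintro _ ⟨U, rfl⟩ _ ⟨V, rfl⟩
    rw [h0, h0, Real.dist_eq, dist_eq_norm]
    exact hf U V
  obtain ⟨F, hF, hFe⟩ := hlo.extend_real
  obtain ⟨G, hG, hGL, hGa⟩ := exists_smooth_approx hF hδ
  obtain ⟨C, hC, hD⟩ := Diff1_of_contDiff hG hGL
  refine ⟨fun U => G (U : Mat N), C, hC, ?_, hD, fun U => ?_⟩
  · intro U V
    have := hGL.dist_le_mul (U : Mat N) (V : Mat N)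
    rwa [Real.dist_eq, dist_eq_norm] at this
  · have h1 := hFe (Set.mem_range_self U)
    rw [h0] at h1
    rw [h1]; exact hGa _

end Smooth

section Final
open scoped Matrix Matrix.Norms.Frobenius
variable {N : ℕ}
variable [MeasurableSpace (UG N)] [BorelSpace (UG N)] (μ : Measure (UG N)) [IsProbabilityMeasure μ]

lemma int_exp_approx {f g : UG N → ℝ} (hf : Continuous f) (hg : Continuous g) {δ : ℝ}
    (h : ∀ U, f U ≤ g U + δ) :
    ∫ U, Real.exp (f U) ∂μ ≤ Real.exp δ * ∫ U, Real.exp (g U) ∂μ := by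
  rw [← integral_const_mul]
  refine integral_mono (cont_int μ (Real.continuous_exp.comp hf))
    ((cont_int μ (Real.continuous_exp.comp hg)).const_mul _) (fun U => ?_)
  show Real.exp (f U) ≤ Real.exp δ * Real.exp (g U)
  rw [← Real.exp_add]
  exact Real.exp_le_exp.2 (by linarith [h U])

lemma mgf_lip (hN : 0 < N) (hH : ∀ g : UG N, MeasurePreserving (fun x => g * x) μ μ)
    {L : ℝ} (hL : 0 ≤ L) {f : UG N → ℝ} (hf : FL L f) :
    (∫ U, Real.exp (f U) ∂μ) * (∫ U, Real.exp (- f U) ∂μ) ≤ Real.exp (9 * L ^ 2 / N) := by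
  have key : ∀ δ : ℝ, 0 < δ →
      (∫ U, Real.exp (f U) ∂μ) * (∫ U, Real.exp (- f U) ∂μ) ≤ Real.exp (2 * δ + 9 * L ^ 2 / N) := by
    intro δ hδ
    obtain ⟨g, C, hC, hg, hD, ha⟩ := exists_smooth_UG hL hf hδ
    have h0 := mgf_smooth μ hN hH hL hC hg hD
    have h1 := int_exp_approx μ hf.continuous hg.continuous (δ := δ)
      (fun U => by linarith [(abs_le.1 (ha U)).1])
    have h2 := int_exp_approx μ hf.continuous.neg hg.continuous.neg (δ := δ)
      (fun U => by simp only [Pi.neg_apply]; linarith [(abs_le.1 (ha U)).2])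
    simp only [Pi.neg_apply] at h2
    have p2 : 0 ≤ ∫ U, Real.exp (- f U) ∂μ := integral_nonneg fun U => (Real.exp_pos _).le
    have p1 : 0 ≤ ∫ U, Real.exp (g U) ∂μ := integral_nonneg fun U => (Real.exp_pos _).le
    refine (mul_le_mul h1 h2 p2 (by positivity)).trans ?_
    rw [Real.exp_add, two_mul, Real.exp_add]
    calc _ = Real.exp δ * Real.exp δ * ((∫ U, Real.exp (g U) ∂μ) * ∫ U, Real.exp (- g U) ∂μ) := by ring
      _ ≤ _ := mul_le_mul_of_nonneg_left h0 (by positivity)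
  have lim : Filter.Tendsto (fun δ : ℝ => Real.exp (2 * δ + 9 * L ^ 2 / N))
      (nhdsWithin 0 (Set.Ioi 0)) (nhds (Real.exp (9 * L ^ 2 / N))) := by
    have hc : Continuous (fun δ : ℝ => Real.exp (2 * δ + 9 * L ^ 2 / N)) := by fun_prop
    have := (hc.tendsto 0).mono_left (nhdsWithin_le_nhds (s := Set.Ioi 0))
    simpa using this
  exact ge_of_tendsto lim (Filter.eventually_of_mem self_mem_nhdsWithin key)

lemma tail_one (hN : 0 < N) (hH : ∀ g : UG N, MeasurePreserving (fun x => g * x) μ μ)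
    {L : ℝ} (hL : 0 ≤ L) {f : UG N → ℝ} (hf : FL L f) (t s : ℝ) (hs : 0 ≤ s) :
    (μ.prod μ) {p | t ≤ f p.1 - f p.2} ≤
      ENNReal.ofReal (Real.exp (- s * t + 9 * (s * L) ^ 2 / N)) := by
  have hsf : FL (s * L) (fun U => s * f U) := by
    intro U V
    rw [← mul_sub, abs_mul, abs_of_nonneg hs, mul_assoc]
    exact mul_le_mul_of_nonneg_left (hf U V) hs
  have h0 := mgf_lip μ hN hH (mul_nonneg hs hL) hsf
  have e : ∀ p : UG N × UG N, Real.exp (s * (f p.1 - f p.2)) =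
      Real.exp (s * f p.1) * Real.exp (- (s * f p.2)) := fun p => by
    rw [← Real.exp_add]; ring_nf
  have i1 : Integrable (fun U => Real.exp (s * f U)) μ :=
    cont_int μ (Real.continuous_exp.comp hsf.continuous)
  have i2 : Integrable (fun U => Real.exp (- (s * f U))) μ :=
    cont_int μ (Real.continuous_exp.comp hsf.continuous.neg)
  have i3 : Integrable (fun p : UG N × UG N => Real.exp (s * (f p.1 - f p.2))) (μ.prod μ) := by
    simp_rw [e]
    exact i1.mul_prod i2
  have h1 := ProbabilityTheory.measure_ge_le_exp_mul_mgf (μ := μ.prod μ)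
    (X := fun p => f p.1 - f p.2) t hs i3
  have h2 : ProbabilityTheory.mgf (fun p : UG N × UG N => f p.1 - f p.2) (μ.prod μ) s
      = (∫ U, Real.exp (s * f U) ∂μ) * (∫ U, Real.exp (- (s * f U)) ∂μ) := by
    unfold ProbabilityTheory.mgf
    simp_rw [e]
    exact integral_prod_mul (fun U => Real.exp (s * f U)) (fun U => Real.exp (- (s * f U)))
  rw [h2] at h1
  rw [← ofReal_measureReal]
  apply ENNReal.ofReal_le_ofReal
  rw [Real.exp_add]
  exact h1.trans (mul_le_mul_of_nonneg_left h0 (Real.exp_pos _).le)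

lemma FL.neg {L : ℝ} {f : UG N → ℝ} (hf : FL L f) : FL L (fun U => - f U) := by
  intro U V
  have := hf U V
  rwa [← abs_neg, show -(-f U - -f V) = f U - f V by ring]

lemma tail_two (hN : 0 < N) (hH : ∀ g : UG N, MeasurePreserving (fun x => g * x) μ μ)
    {L : ℝ} (hL : 0 < L) {f : UG N → ℝ} (hf : FL L f) (t : ℝ) (ht : 0 < t) :
    (μ.prod μ) {p | t ≤ |f p.1 - f p.2|} ≤
      ENNReal.ofReal (2 * Real.exp (-(((N : ℝ) - 2) * t ^ 2) / (48 * L ^ 2))) := by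
  rcases le_or_gt (N : ℝ) 2 with h2 | h2
  · refine prob_le_one.trans ?_
    rw [← ENNReal.ofReal_one]
    apply ENNReal.ofReal_le_ofReal
    have : 0 ≤ -(((N : ℝ) - 2) * t ^ 2) / (48 * L ^ 2) := by
      apply div_nonneg _ (by positivity)
      nlinarith [sq_nonneg t]
    linarith [Real.one_le_exp this]
  · set a : ℝ := (N : ℝ) - 2 with ha
    have ha0 : 0 < a := by linarith
    have haN : a ≤ N := by linarith
    set s : ℝ := t * a / (24 * L ^ 2) with hs
    have hs0 : 0 ≤ s := by positivity
    have hle : - s * t + 9 * (s * L) ^ 2 / N ≤ -(a * t ^ 2) / (48 * L ^ 2) := by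
      have h1 : 9 * (s * L) ^ 2 / N ≤ 12 * (s * L) ^ 2 / a := by
        apply div_le_div₀ (by positivity) _ ha0 haN
        nlinarith [sq_nonneg (s * L)]
      have h3 : - s * t + 12 * (s * L) ^ 2 / a = -(a * t ^ 2) / (48 * L ^ 2) := by
        rw [hs]; field_simp; ring
      linarith
    have hE : ENNReal.ofReal (Real.exp (- s * t + 9 * (s * L) ^ 2 / N)) ≤
        ENNReal.ofReal (Real.exp (-(a * t ^ 2) / (48 * L ^ 2))) :=
      ENNReal.ofReal_le_ofReal (Real.exp_le_exp.2 hle)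
    have t1 := (tail_one μ hN hH hL.le hf t s hs0).trans hE
    have t2 := (tail_one μ hN hH hL.le hf.neg t s hs0).trans hE
    have hsub : {p : UG N × UG N | t ≤ |f p.1 - f p.2|} ⊆
        {p | t ≤ f p.1 - f p.2} ∪ {p | t ≤ - f p.1 - - f p.2} := by
      intro p hp
      rcases le_abs.1 (show t ≤ |f p.1 - f p.2| from hp) with h | h
      · exact Or.inl h
      · exact Or.inr (show t ≤ - f p.1 - - f p.2 by linarith)
    refine (measure_mono hsub).trans ((measure_union_le _ _).trans ((add_le_add t1 t2).trans ?_))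
    rw [← ENNReal.ofReal_add (Real.exp_pos _).le (Real.exp_pos _).le, two_mul]

end Final

/-- Let `N ≥ 1`, `L > 0`, and let `f : U(N) → ℝ` be `L`-Lipschitz with
respect to the Frobenius norm.  Then for every `t > 0`, sampling `U, U'` independently
from the Haar probability measure `μ_N` on the compact group `U(N)` (formalized as a
left-invariant Borel probability measure, which on `U(N)` is unique, hence Haar),
`(μ_N × μ_N) {(U,U') : |f U − f U'| ≥ t} ≤ 2·exp(−(N−2)·t²/(48·L²))`. -/
theorem stmt_3 (N : ℕ) (hN : 0 < N)
    [MeasurableSpace (Matrix.unitaryGroup (Fin N) ℂ)]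
    [BorelSpace (Matrix.unitaryGroup (Fin N) ℂ)]
    (μ : Measure (Matrix.unitaryGroup (Fin N) ℂ)) [IsProbabilityMeasure μ]
    (hHaar : ∀ g : Matrix.unitaryGroup (Fin N) ℂ,
      MeasurePreserving (fun x => g * x) μ μ)
    (L : ℝ) (hL : 0 < L)
    (f : Matrix.unitaryGroup (Fin N) ℂ → ℝ)
    (hf : ∀ U V : Matrix.unitaryGroup (Fin N) ℂ,
      |f U - f V| ≤ L * frobNorm ((U : Matrix (Fin N) (Fin N) ℂ) - (V : Matrix (Fin N) (Fin N) ℂ)))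
    (t : ℝ) (ht : 0 < t) :
    (μ.prod μ) {p | t ≤ |f p.1 - f p.2|} ≤
      ENNReal.ofReal (2 * Real.exp (-(((N : ℝ) - 2) * t ^ 2) / (48 * L ^ 2))) := by
  refine tail_two μ hN hHaar hL (fun U V => ?_) t ht
  have := hf U V
  rwa [frobNorm_eq] at this
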